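/- Fix real parameters a > 0, b ∈ (0,1), and a compact interval I ⊂ (−∞, 0). Let W : [0,∞) → [0,∞) be the function assigning to w ≥ 0 the unique t ≥ 0 with t·exp(t) = w. Then there exist ε₀ > 0, β > 0, and a function h : I × [0, β] → ℝ, smooth in both variables, with h(x, 0) = 2 for all x ∈ I, such that for every ε ∈ (0, ε₀): W(−x/(εb))⁻¹ ∈ [0, β] for all x ∈ I, and the graph {(x, Y(x,ε)) : x ∈ I}, where Y(x,ε) = ε·W(−x/(εb))·(1 − ε·b·x⁻¹·h(x, W(−x/(εb))⁻¹)), is invariant for the Le Corbeiller system, i.e. −x + b·Y(x,ε)·(2 − exp(Y(x,ε)/ε)) = ∂Y/∂x(x,ε)·(Y(x,ε) + a) for all x ∈ I. -/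

import Mathlib

open Set Filter Topology Metric
open scoped ContDiff

/-- A uniform contraction depending smoothly on a parameter has a fixed point depending smoothly
on the parameter. -/
theorem exists_contDiffOn_fixedPoint {P X : Type*} [NormedAddCommGroup P] [NormedSpace ℝ P]
    [CompleteSpace P] [NormedAddCommGroup X] [NormedSpace ℝ X] [CompleteSpace X] {U : Set P}
    (hU : IsOpen U) {F : P × X → X} {x₀ : X} {ρ ρ' q : ℝ} (h0 : 0 ≤ ρ') (hρ : ρ' < ρ)
    (hq0 : 0 ≤ q) (hq1 : q < 1) (hF : ContDiffOn ℝ ∞ F (U ×ˢ ball x₀ ρ))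
    (hmaps : ∀ p ∈ U, ∀ y ∈ closedBall x₀ ρ, F (p, y) ∈ closedBall x₀ ρ')
    (hlip : ∀ p ∈ U, ∀ y ∈ closedBall x₀ ρ, ∀ z ∈ closedBall x₀ ρ,
      ‖F (p, y) - F (p, z)‖ ≤ q * ‖y - z‖) :
    ∃ γ : P → X, ContDiffOn ℝ ∞ γ U ∧ (∀ p ∈ U, γ p ∈ closedBall x₀ ρ' ∧ F (p, γ p) = γ p) ∧
      ∀ p ∈ U, ∀ y ∈ closedBall x₀ ρ, F (p, y) = y → y = γ p := by
  lift q to NNReal using hq0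
  have hex : ∀ p ∈ U, ∃ y ∈ closedBall x₀ ρ', F (p, y) = y := by
    intro p hp
    have hmt : MapsTo (fun y => F (p, y)) (closedBall x₀ ρ) (closedBall x₀ ρ) := fun y hy =>
      closedBall_subset_closedBall hρ.le (hmaps p hp y hy)
    have hc : ContractingWith q (hmt.restrict _ _ _) := by
      refine ⟨by exact_mod_cast hq1, LipschitzWith.of_dist_le_mul ?_⟩
      rintro ⟨y, hy⟩ ⟨z, hz⟩
      simpa [Subtype.dist_eq, dist_eq_norm] using hlip p hp y hy z hz
    obtain ⟨y, hy, hfix, -⟩ := hc.exists_fixedPoint' isClosed_closedBall.isComplete hmt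
      (mem_closedBall_self (h0.trans hρ.le)) (edist_ne_top _ _)
    refine ⟨y, ?_, hfix⟩
    have := hmaps p hp y hy
    rwa [show F (p, y) = y from hfix] at this
  choose! γ hγ hγF using hex
  have huniq : ∀ p ∈ U, ∀ y ∈ closedBall x₀ ρ, F (p, y) = y → y = γ p := by
    intro p hp y hy hFy
    have h1 := hlip p hp y hy (γ p) (closedBall_subset_closedBall hρ.le (hγ p hp))
    rw [hFy, hγF p hp] at h1
    have h2 : ‖y - γ p‖ = 0 := by nlinarith [norm_nonneg (y - γ p)]
    exact sub_eq_zero.1 (norm_eq_zero.1 h2)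
  refine ⟨γ, ?_, fun p hp => ⟨hγ p hp, hγF p hp⟩, huniq⟩
  intro p hp
  have hball : γ p ∈ ball x₀ ρ := closedBall_subset_ball hρ (hγ p hp)
  have hnhds : U ×ˢ ball x₀ ρ ∈ 𝓝 (p, γ p) := (hU.prod isOpen_ball).mem_nhds ⟨hp, hball⟩
  have hFat : ContDiffAt ℝ ∞ F (p, γ p) := hF.contDiffAt hnhds
  have hne : (∞ : WithTop ℕ∞) ≠ 0 := by simp
  let G : P × X → X := fun v => v.2 - F v
  have hG : ContDiffAt ℝ ∞ G (p, γ p) := contDiffAt_snd.sub hFat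
  have hFd := (hFat.differentiableAt hne).hasFDerivAt
  set A : X →L[ℝ] X := fderiv ℝ F (p, γ p) ∘L .inr ℝ P X with hA
  have hAd : HasFDerivAt (fun y => F (p, y)) A (γ p) :=
    HasFDerivAt.comp (γ p) hFd (hasFDerivAt_prodMk_right p (γ p))
  have hAn : ‖A‖ ≤ q := by
    refine hAd.le_of_lip' q.2 ?_
    filter_upwards [isOpen_ball.mem_nhds hball] with y hy
    exact hlip p hp y (ball_subset_closedBall hy) _ (ball_subset_closedBall hball)
  have hGA : fderiv ℝ G (p, γ p) ∘L .inr ℝ P X = 1 - A := by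
    have : HasFDerivAt G (ContinuousLinearMap.snd ℝ P X - fderiv ℝ F (p, γ p)) (p, γ p) :=
      hasFDerivAt_snd.sub hFd
    rw [this.fderiv, hA]
    ext v
    simp
  have hinv : (fderiv ℝ G (p, γ p) ∘L .inr ℝ P X).IsInvertible := by
    rw [hGA]
    exact ⟨ContinuousLinearEquiv.ofUnit (Units.oneSub A (hAn.trans_lt hq1)), rfl⟩
  have hsm := hG.contDiffAt_implicitFunction hne hinv
  have hev := hG.eventually_apply_implicitFunction hne hinv
  have hcont : ContinuousAt (hG.implicitFunction hne hinv) p := hsm.continuousAt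
  have hself : hG.implicitFunction hne hinv p = γ p := hG.implicitFunction_apply_self hne hinv
  refine (hsm.congr_of_eventuallyEq ?_).contDiffWithinAt
  have hb : ∀ᶠ x in 𝓝 p, hG.implicitFunction hne hinv x ∈ ball x₀ ρ :=
    hcont (by rw [hself]; exact isOpen_ball.mem_nhds hball)
  filter_upwards [hev, hb, hU.mem_nhds hp] with x hx hxb hxU
  refine (huniq x hxU _ (ball_subset_closedBall hxb) ?_).symm
  have : G (p, γ p) = 0 := by simp [G, hγF p hp]
  rw [this] at hx
  exact (sub_eq_zero.1 hx).symm

/-- A bilinear map acts pointwise and smoothly on spaces of continuous functions. -/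
theorem ContinuousMap.exists_contDiff_bilinear {K E F G : Type} [TopologicalSpace K]
    [CompactSpace K] [NormedAddCommGroup E] [NormedSpace ℝ E] [NormedAddCommGroup F]
    [NormedSpace ℝ F] [NormedAddCommGroup G] [NormedSpace ℝ G] (B : G →L[ℝ] E →L[ℝ] F) :
    ∃ A : C(K, G) → C(K, E) →L[ℝ] C(K, F), (∀ φ h k, A φ h k = B (φ k) (h k)) ∧
      ContDiff ℝ ∞ A := by
  let A : C(K, G) →L[ℝ] C(K, E) →L[ℝ] C(K, F) :=
    LinearMap.mkContinuous₂
      (LinearMap.mk₂ ℝ (fun (φ : C(K, G)) (h : C(K, E)) =>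
          (⟨fun k => B (φ k) (h k), by fun_prop⟩ : C(K, F)))
        (by intros; ext; simp) (by intros; ext; simp) (by intros; ext; simp)
        (by intros; ext; simp)) ‖B‖ (by
      intro φ h
      rw [ContinuousMap.norm_le _ (by positivity)]
      intro k
      refine (B.le_opNorm₂ _ _).trans ?_
      gcongr
      · exact φ.norm_coe_le_norm k
      · exact h.norm_coe_le_norm k)
  exact ⟨A, fun _ _ _ => rfl, A.contDiff⟩

/-- Postcomposition with a smooth map is a smooth map between spaces of continuous functions. -/
theorem ContinuousMap.contDiff_postcomp {K E : Type} [TopologicalSpace K] [CompactSpace K]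
    [NormedAddCommGroup E] [NormedSpace ℝ E] (n : ℕ) :
    ∀ {F : Type} [NormedAddCommGroup F] [NormedSpace ℝ F] (f : C(E, F)), ContDiff ℝ ∞ f →
      ContDiff ℝ n (fun γ : C(K, E) => f.comp γ) := by
  induction n with
  | zero =>
    intro F _ _ f hf
    exact contDiff_zero.2 (ContinuousMap.continuous_postcomp f)
  | succ n ih =>
    intro F _ _ f hf
    let f' : C(E, E →L[ℝ] F) := ⟨fderiv ℝ f, hf.continuous_fderiv (by simp)⟩
    have hf' : ContDiff ℝ ∞ f' := hf.fderiv_right (by simp)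
    obtain ⟨A, hA, hAs⟩ :=
      exists_contDiff_bilinear (K := K) (ContinuousLinearMap.id ℝ (E →L[ℝ] F))
    have hAc : ContDiff ℝ n (fun γ : C(K, E) => A (f'.comp γ)) :=
      (hAs.of_le (by exact_mod_cast le_top)).comp (ih f' hf')
    refine contDiff_succ_iff_hasFDerivAt.2 ⟨fun γ => A (f'.comp γ), hAc, ?_⟩
    intro γ
    rw [hasFDerivAt_iff_isLittleO_nhds_zero, Asymptotics.isLittleO_iff]
    intro c hc
    obtain ⟨δ, hδ, hδ'⟩ := Metric.continuous_iff.1 (ih f' hf').continuous γ c hc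
    filter_upwards [ball_mem_nhds (0 : C(K, E)) hδ] with h hh
    rw [ContinuousMap.norm_le _ (by positivity)]
    intro k
    have hd : ∀ z, DifferentiableAt ℝ f z := fun z => (hf.differentiable (by simp)) z
    have key := Convex.norm_image_sub_le_of_norm_fderiv_le' (𝕜 := ℝ) (f := f) (C := c)
      (s := segment ℝ (γ k) (γ k + h k)) (x := γ k) (y := γ k + h k) (φ := fderiv ℝ f (γ k))
      (fun z _ => hd z) (by
        intro z hz
        rw [segment_eq_image'] at hz
        obtain ⟨τ, hτ, rfl⟩ := hz
        have h1 : dist (γ + τ • h) γ < δ := by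
          rw [dist_eq_norm, add_sub_cancel_left, norm_smul, Real.norm_of_nonneg hτ.1]
          have : ‖h‖ < δ := by simpa using hh
          nlinarith [norm_nonneg h, hτ.2]
        have h2 := (ContinuousMap.dist_apply_le_dist k).trans_lt (hδ' _ h1)
        rw [dist_eq_norm] at h2
        simpa [f'] using h2.le) (convex_segment _ _) (left_mem_segment _ _ _)
        (right_mem_segment _ _ _)
    simp only [add_sub_cancel_left] at key
    simp only [ContinuousMap.sub_apply, ContinuousMap.comp_apply, ContinuousMap.add_apply, hA]
    exact key.trans (mul_le_mul_of_nonneg_left (h.norm_coe_le_norm k) hc.le)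

/-- All derivatives of `f` up to order `n` are bounded on `Q`, where `f` is smooth. -/
def HasBoundedDerivs {E F : Type} [NormedAddCommGroup E] [NormedSpace ℝ E] [NormedAddCommGroup F]
    [NormedSpace ℝ F] (Q : Set E) : ℕ → (E → F) → Prop
  | 0, f => ContDiffOn ℝ ∞ f Q ∧ ∃ C, ∀ p ∈ Q, ‖f p‖ ≤ C
  | n + 1, f => (ContDiffOn ℝ ∞ f Q ∧ ∃ C, ∀ p ∈ Q, ‖f p‖ ≤ C) ∧
      ∀ v, HasBoundedDerivs Q n (fun p => fderiv ℝ f p v)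

namespace HasBoundedDerivs

variable {E F G V : Type} [NormedAddCommGroup E] [NormedSpace ℝ E] [NormedAddCommGroup F]
  [NormedSpace ℝ F] [NormedAddCommGroup G] [NormedSpace ℝ G] [NormedAddCommGroup V]
  [NormedSpace ℝ V] {Q : Set E} {n : ℕ}

theorem zero_order {f : E → F} (hf : HasBoundedDerivs Q n f) :
    ContDiffOn ℝ ∞ f Q ∧ ∃ C, ∀ p ∈ Q, ‖f p‖ ≤ C := by
  cases n with
  | zero => exact hf
  | succ n => exact hf.1

theorem of_succ {f : E → F} (hf : HasBoundedDerivs Q (n + 1) f) : HasBoundedDerivs Q n f := by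
  induction n generalizing f with
  | zero => exact hf.1
  | succ n ih => exact ⟨hf.1, fun v => ih (hf.2 v)⟩

theorem congr (hQ : IsOpen Q) {f g : E → F} (hf : HasBoundedDerivs Q n f)
    (h : ∀ p ∈ Q, g p = f p) : HasBoundedDerivs Q n g := by
  have key : ∀ {f g : E → F}, (∀ p ∈ Q, g p = f p) →
      (ContDiffOn ℝ ∞ f Q ∧ ∃ C, ∀ p ∈ Q, ‖f p‖ ≤ C) →
      (ContDiffOn ℝ ∞ g Q ∧ ∃ C, ∀ p ∈ Q, ‖g p‖ ≤ C) := by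
    rintro f g h ⟨h1, C, hC⟩
    exact ⟨h1.congr h, C, fun p hp => by rw [h p hp]; exact hC p hp⟩
  induction n generalizing f g with
  | zero => exact key h hf
  | succ n ih =>
    refine ⟨key h hf.1, fun v => ih (hf.2 v) fun p hp => ?_⟩
    have : g =ᶠ[𝓝 p] f := by
      filter_upwards [hQ.mem_nhds hp] with q hq using h q hq
    rw [this.fderiv_eq]

theorem differentiableAt (hQ : IsOpen Q) {f : E → F} (hf : HasBoundedDerivs Q n f) {p : E}
    (hp : p ∈ Q) : DifferentiableAt ℝ f p :=
  (hf.zero_order.1.contDiffAt (hQ.mem_nhds hp)).differentiableAt (by simp)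

theorem const (c : F) : HasBoundedDerivs Q n (fun _ : E => c) := by
  induction n generalizing c with
  | zero => exact ⟨contDiffOn_const, ‖c‖, fun _ _ => le_rfl⟩
  | succ n ih =>
    refine ⟨⟨contDiffOn_const, ‖c‖, fun _ _ => le_rfl⟩, fun v => ?_⟩
    simpa using ih 0

theorem add (hQ : IsOpen Q) {f g : E → F} (hf : HasBoundedDerivs Q n f)
    (hg : HasBoundedDerivs Q n g) : HasBoundedDerivs Q n (fun p => f p + g p) := by
  have key : ∀ {f g : E → F}, (ContDiffOn ℝ ∞ f Q ∧ ∃ C, ∀ p ∈ Q, ‖f p‖ ≤ C) →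
      (ContDiffOn ℝ ∞ g Q ∧ ∃ C, ∀ p ∈ Q, ‖g p‖ ≤ C) →
      (ContDiffOn ℝ ∞ (fun p => f p + g p) Q ∧ ∃ C, ∀ p ∈ Q, ‖f p + g p‖ ≤ C) := by
    rintro f g ⟨h1, C, hC⟩ ⟨h2, D, hD⟩
    exact ⟨h1.add h2, C + D, fun p hp => norm_add_le_of_le (hC p hp) (hD p hp)⟩
  induction n generalizing f g with
  | zero => exact key hf hg
  | succ n ih =>
    refine ⟨key hf.1 hg.1, fun v => (ih (hf.2 v) (hg.2 v)).congr hQ fun p hp => ?_⟩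
    rw [fderiv_fun_add (hf.differentiableAt hQ hp) (hg.differentiableAt hQ hp)]
    rfl

theorem prodMk (hQ : IsOpen Q) {f : E → F} {g : E → G} (hf : HasBoundedDerivs Q n f)
    (hg : HasBoundedDerivs Q n g) : HasBoundedDerivs Q n (fun p => (f p, g p)) := by
  have key : ∀ {f : E → F} {g : E → G}, (ContDiffOn ℝ ∞ f Q ∧ ∃ C, ∀ p ∈ Q, ‖f p‖ ≤ C) →
      (ContDiffOn ℝ ∞ g Q ∧ ∃ C, ∀ p ∈ Q, ‖g p‖ ≤ C) →
      (ContDiffOn ℝ ∞ (fun p => (f p, g p)) Q ∧ ∃ C, ∀ p ∈ Q, ‖(f p, g p)‖ ≤ C) := by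
    rintro f g ⟨h1, C, hC⟩ ⟨h2, D, hD⟩
    exact ⟨h1.prodMk h2, max C D, fun p hp => max_le_max (hC p hp) (hD p hp)⟩
  induction n generalizing f g with
  | zero => exact key hf hg
  | succ n ih =>
    refine ⟨key hf.1 hg.1, fun v => (ih (hf.2 v) (hg.2 v)).congr hQ fun p hp => ?_⟩
    rw [(hf.differentiableAt hQ hp).fderiv_prodMk (hg.differentiableAt hQ hp)]
    rfl

theorem clm_apply (hQ : IsOpen Q) {c : E → V →L[ℝ] F} {u : E → V} (hc : HasBoundedDerivs Q n c)
    (hu : HasBoundedDerivs Q n u) : HasBoundedDerivs Q n (fun p => c p (u p)) := by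
  have key : ∀ {c : E → V →L[ℝ] F} {u : E → V},
      (ContDiffOn ℝ ∞ c Q ∧ ∃ C, ∀ p ∈ Q, ‖c p‖ ≤ C) →
      (ContDiffOn ℝ ∞ u Q ∧ ∃ C, ∀ p ∈ Q, ‖u p‖ ≤ C) →
      (ContDiffOn ℝ ∞ (fun p => c p (u p)) Q ∧ ∃ C, ∀ p ∈ Q, ‖c p (u p)‖ ≤ C) := by
    rintro f g ⟨h1, C, hC⟩ ⟨h2, D, hD⟩
    refine ⟨h1.clm_apply h2, C * D, fun p hp => ((f p).le_opNorm _).trans ?_⟩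
    exact mul_le_mul (hC p hp) (hD p hp) (norm_nonneg _) ((norm_nonneg _).trans (hC p hp))
  induction n generalizing c u with
  | zero => exact key hc hu
  | succ n ih =>
    refine ⟨key hc.1 hu.1, fun v => ((ih (hc.2 v) hu.of_succ).add hQ
      (ih hc.of_succ (hu.2 v))).congr hQ fun p hp => ?_⟩
    have := ((hc.differentiableAt hQ hp).hasFDerivAt.clm_apply
      (hu.differentiableAt hQ hp).hasFDerivAt).fderiv
    rw [this]
    simp [add_comm]

theorem comp [FiniteDimensional ℝ V] (hQ : IsOpen Q) {Φ : V → F} (hΦ : ContDiff ℝ ∞ Φ) {f : E → V}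
    (hf : HasBoundedDerivs Q n f) : HasBoundedDerivs Q n (fun p => Φ (f p)) := by
  have key : ∀ {F : Type} [NormedAddCommGroup F] [NormedSpace ℝ F] {Φ : V → F},
      ContDiff ℝ ∞ Φ → (ContDiffOn ℝ ∞ f Q ∧ ∃ C, ∀ p ∈ Q, ‖f p‖ ≤ C) →
      (ContDiffOn ℝ ∞ (fun p => Φ (f p)) Q ∧ ∃ C, ∀ p ∈ Q, ‖Φ (f p)‖ ≤ C) := by
    rintro F _ _ Φ hΦ ⟨h2, D, hD⟩
    have : ProperSpace V := FiniteDimensional.proper ℝ V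
    obtain ⟨C, hC⟩ := (isCompact_closedBall (0 : V) D).exists_bound_of_continuousOn
      hΦ.continuous.continuousOn
    exact ⟨hΦ.comp_contDiffOn h2, C, fun p hp => hC _ (by simpa using hD p hp)⟩
  induction n generalizing F with
  | zero => exact key hΦ hf
  | succ n ih =>
    refine ⟨key hΦ hf.1, fun v => ?_⟩
    have h1 : HasBoundedDerivs Q n (fun p => fderiv ℝ Φ (f p)) :=
      ih (hΦ.fderiv_right (by simp)) hf.of_succ
    refine (h1.clm_apply hQ (hf.2 v)).congr hQ fun p hp => ?_
    have := ((hΦ.differentiable (by simp) (f p)).hasFDerivAt.comp p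
      (hf.differentiableAt hQ hp).hasFDerivAt).fderiv
    change fderiv ℝ (Φ ∘ f) p v = _
    rw [this]
    rfl

theorem mul (hQ : IsOpen Q) {f g : E → ℝ} (hf : HasBoundedDerivs Q n f)
    (hg : HasBoundedDerivs Q n g) : HasBoundedDerivs Q n (fun p => f p * g p) :=
  (hf.prodMk hQ hg).comp hQ (Φ := fun v : ℝ × ℝ => v.1 * v.2) (by fun_prop)

end HasBoundedDerivs

/-- Directional derivatives commute. -/
theorem fderiv_fderiv_apply_comm {E F : Type} [NormedAddCommGroup E] [NormedSpace ℝ E]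
    [NormedAddCommGroup F] [NormedSpace ℝ F] {f : E → F} {p : E} (hf : ContDiffAt ℝ ∞ f p)
    (v w : E) : fderiv ℝ (fun q => fderiv ℝ f q v) p w = fderiv ℝ (fun q => fderiv ℝ f q w) p v := by
  have hd : DifferentiableAt ℝ (fderiv ℝ f) p :=
    (hf.fderiv_right (m := ∞) (by simp)).differentiableAt (by simp)
  have h : ∀ u, HasFDerivAt (fun q => fderiv ℝ f q u)
      ((fderiv ℝ (fderiv ℝ f) p).flip u) p := fun u => by
    simpa using hd.hasFDerivAt.clm_apply (hasFDerivAt_const u p)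
  rw [(h v).fderiv, (h w).fderiv]
  exact hf.isSymmSndFDerivAt (by simpa using WithTop.coe_le_coe.2 (le_top : (2 : ℕ∞) ≤ ⊤)) w v

/-- The strip on which the fast-time initial value problems are solved. -/
def strip (S T₀ : ℝ) : Set (ℝ × ℝ) := Ioo 0 S ×ˢ Ioi T₀

theorem isOpen_strip (S T₀ : ℝ) : IsOpen (strip S T₀) := isOpen_Ioo.prod isOpen_Ioi

theorem hasBoundedDerivs_fst (n : ℕ) (S T₀ : ℝ) :
    HasBoundedDerivs (strip S T₀) n (fun p : ℝ × ℝ => p.1) := by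
  have h : ContDiffOn ℝ ∞ (fun p : ℝ × ℝ => p.1) (strip S T₀) ∧ ∃ C, ∀ p ∈ strip S T₀, ‖p.1‖ ≤ C :=
    ⟨contDiffOn_fst, S, fun p hp => by rw [Real.norm_of_nonneg hp.1.1.le]; exact hp.1.2.le⟩
  cases n with
  | zero => exact h
  | succ n =>
    refine ⟨h, fun v => (HasBoundedDerivs.const v.1).congr (isOpen_strip S T₀) fun p hp => ?_⟩
    rw [hasFDerivAt_fst.fderiv]
    rfl

theorem hasFDerivAt_of_snd {f : ℝ → ℝ} {f' : ℝ} {p : ℝ × ℝ} (h : HasDerivAt f f' p.2) :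
    HasFDerivAt (fun q : ℝ × ℝ => f q.2) (f' • ContinuousLinearMap.snd ℝ ℝ ℝ) p :=
  h.comp_hasFDerivAt p hasFDerivAt_snd

theorem hasBoundedDerivs_inv_snd (n : ℕ) (S : ℝ) {T₀ : ℝ} (hT : 1 ≤ T₀) :
    HasBoundedDerivs (strip S T₀) n (fun p : ℝ × ℝ => p.2⁻¹) := by
  have h : ContDiffOn ℝ ∞ (fun p : ℝ × ℝ => p.2⁻¹) (strip S T₀) ∧
      ∃ C, ∀ p ∈ strip S T₀, ‖p.2⁻¹‖ ≤ C := by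
    refine ⟨contDiffOn_snd.inv fun p hp => ?_, 1, fun p hp => ?_⟩
    · have : T₀ < p.2 := hp.2
      linarith
    · have : T₀ < p.2 := hp.2
      rw [Real.norm_of_nonneg (inv_nonneg.2 (by linarith))]
      exact inv_le_one_of_one_le₀ (by linarith)
  induction n with
  | zero => exact h
  | succ n ih =>
    have hQ := isOpen_strip S T₀
    refine ⟨h, fun v => ((HasBoundedDerivs.const (-v.2)).mul hQ (ih.mul hQ ih)).congr hQ
      fun p hp => ?_⟩
    have h2 : T₀ < p.2 := hp.2
    rw [(hasFDerivAt_of_snd (hasDerivAt_inv (by linarith : p.2 ≠ 0))).fderiv]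
    simp
    field_simp

theorem hasBoundedDerivs_exp_neg_snd (n : ℕ) (S : ℝ) {T₀ : ℝ} (hT : 1 ≤ T₀) :
    HasBoundedDerivs (strip S T₀) n (fun p : ℝ × ℝ => Real.exp (-p.2)) := by
  have h : ContDiffOn ℝ ∞ (fun p : ℝ × ℝ => Real.exp (-p.2)) (strip S T₀) ∧
      ∃ C, ∀ p ∈ strip S T₀, ‖Real.exp (-p.2)‖ ≤ C := by
    refine ⟨by fun_prop, 1, fun p hp => ?_⟩
    have : T₀ < p.2 := hp.2
    rw [Real.norm_of_nonneg (by positivity), Real.exp_le_one_iff]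
    linarith
  induction n with
  | zero => exact h
  | succ n ih =>
    have hQ := isOpen_strip S T₀
    refine ⟨h, fun v => ((HasBoundedDerivs.const (-v.2)).mul hQ ih).congr hQ fun p hp => ?_⟩
    rw [(hasFDerivAt_of_snd (f := fun T => Real.exp (-T)) (hasDerivAt_neg p.2).exp).fderiv]
    simp
    ring

/-- Derivative bounds for a singularly perturbed linear equation with a decaying coefficient. -/
theorem hasBoundedDerivs_of_linear {S T₀ s₀ c₀ : ℝ} (hT : 1 ≤ T₀) (hs₀ : 0 < s₀) (hc₀ : 0 < c₀)
    {n : ℕ} {u c f : ℝ × ℝ → ℝ} (hu : ContDiffOn ℝ ∞ u (strip S T₀))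
    (hu0 : ∀ p ∈ strip S T₀, p.1 < s₀ → u p = 0)
    (heq : ∀ p ∈ strip S T₀,
      fderiv ℝ u p (1, 0) = p.2 * Real.exp p.2 * (c p * u p + f p))
    (hc : HasBoundedDerivs (strip S T₀) n c) (hcneg : ∀ p ∈ strip S T₀, c p ≤ -c₀)
    (hf : HasBoundedDerivs (strip S T₀) n f) : HasBoundedDerivs (strip S T₀) n u := by
  have hQ := isOpen_strip S T₀
  induction n generalizing u f with
  | zero =>
    refine ⟨hu, ?_⟩
    obtain ⟨-, C, hC⟩ := hf
    have hle : ∀ {u f : ℝ × ℝ → ℝ}, ContDiffOn ℝ ∞ u (strip S T₀) →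
        (∀ p ∈ strip S T₀, p.1 < s₀ → u p = 0) →
        (∀ p ∈ strip S T₀, fderiv ℝ u p (1, 0) = p.2 * Real.exp p.2 * (c p * u p + f p)) →
        (∀ p ∈ strip S T₀, ‖f p‖ ≤ C) → ∀ p ∈ strip S T₀, u p ≤ (|C| + 1) / c₀ := by
      intro u f hu hu0 heq hC p hp
      obtain ⟨s, T⟩ := p
      obtain ⟨⟨hs0, hsS⟩, hT'⟩ := hp
      simp only [mem_Ioi] at hs0 hsS hT'
      by_cases hss : s < s₀
      · rw [hu0 (s, T) ⟨⟨hs0, hsS⟩, hT'⟩ hss]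
        positivity
      have hmem : ∀ x ∈ Icc (s₀ / 2) s, ((x, T) : ℝ × ℝ) ∈ strip S T₀ := fun x hx =>
        ⟨⟨by simp only; linarith [hx.1], by simp only; linarith [hx.2]⟩, hT'⟩
      have hder : ∀ x ∈ Icc (s₀ / 2) s, HasDerivAt (fun x => u (x, T))
          (T * Real.exp T * (c (x, T) * u (x, T) + f (x, T))) x := by
        intro x hx
        have h1 := (hu.contDiffAt (hQ.mem_nhds (hmem x hx))).differentiableAt (by simp)
        have h2 := h1.hasFDerivAt.comp_hasDerivAt x ((hasDerivAt_id x).prodMk (hasDerivAt_const x T))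
        rw [heq _ (hmem x hx)] at h2
        exact h2
      refine image_le_of_deriv_right_lt_deriv_boundary (f := fun x => u (x, T))
        (B := fun _ => (|C| + 1) / c₀) (B' := fun _ => 0) (a := s₀ / 2) (b := s)
        (fun x hx => (hder x hx).continuousAt.continuousWithinAt)
        (fun x hx => (hder x (Ico_subset_Icc_self hx)).hasDerivWithinAt) ?_
        (fun x => hasDerivAt_const x _) ?_ ⟨by linarith, le_rfl⟩
      · rw [hu0 _ (hmem _ ⟨le_rfl, by linarith⟩) (by simp; linarith)]
        positivity
      · intro x hx hxe
        have hm := hmem x (Ico_subset_Icc_self hx)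
        have h1 := hcneg _ hm
        have h2 := (le_abs_self _).trans ((hC _ hm).trans (le_abs_self C))
        rw [hxe]
        have h3 : c (x, T) * ((|C| + 1) / c₀) ≤ -c₀ * ((|C| + 1) / c₀) :=
          mul_le_mul_of_nonneg_right h1 (by positivity)
        have h4 : -c₀ * ((|C| + 1) / c₀) = -(|C| + 1) := by field_simp
        have h5 : 0 < T * Real.exp T := mul_pos (by linarith) (Real.exp_pos _)
        exact mul_neg_of_pos_of_neg h5 (by linarith)
    refine ⟨(|C| + 1) / c₀, fun p hp => abs_le.2 ⟨?_, hle hu hu0 heq hC p hp⟩⟩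
    have := hle (u := fun p => -u p) (f := fun p => -f p) hu.neg
      (fun p hp h => by rw [hu0 p hp h, neg_zero]) (fun p hp => by
        rw [show (fun p => -u p) = -u from rfl, fderiv_neg, neg_apply,
          heq p hp]
        ring) (by simpa using hC) p hp
    linarith
  | succ n ih =>
    have hun := ih hu hu0 heq hc.of_succ hf.of_succ
    refine ⟨hun.zero_order, fun v => ?_⟩
    have hinv := hasBoundedDerivs_inv_snd n S hT
    refine ih (f := fun p => v.2 * ((1 + p.2⁻¹) * (c p * u p + f p)) +
      (fderiv ℝ c p v * u p + fderiv ℝ f p v)) ?_ ?_ ?_ hc.of_succ ?_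
    · exact ((hu.fderiv_of_isOpen hQ (by simp)).clm_apply contDiffOn_const)
    · intro p hp hps
      have : u =ᶠ[𝓝 p] fun _ => 0 := by
        filter_upwards [hQ.mem_nhds hp, (isOpen_Iio.preimage continuous_fst).mem_nhds hps]
          with q hq hq' using hu0 q hq hq'
      rw [this.fderiv_eq]
      simp
    · intro p hp
      have hp2 : T₀ < p.2 := hp.2
      have hp0 : p.2 ≠ 0 := by linarith
      rw [fderiv_fderiv_apply_comm (hu.contDiffAt (hQ.mem_nhds hp)) v (1, 0)]
      have hev : (fun q => fderiv ℝ u q (1, 0)) =ᶠ[𝓝 p]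
          fun q => q.2 * Real.exp q.2 * (c q * u q + f q) := by
        filter_upwards [hQ.mem_nhds hp] with q hq using heq q hq
      rw [hev.fderiv_eq]
      have h1 := hasFDerivAt_of_snd (f := fun T => T * Real.exp T)
        ((hasDerivAt_id p.2).mul (Real.hasDerivAt_exp p.2))
      have h2 := ((hc.differentiableAt hQ hp).hasFDerivAt.mul
        (hun.differentiableAt hQ hp).hasFDerivAt).add (hf.differentiableAt hQ hp).hasFDerivAt
      rw [show (fun q : ℝ × ℝ => q.2 * Real.exp q.2 * (c q * u q + f q)) =
        (fun q : ℝ × ℝ => q.2 * Real.exp q.2) * (c * u + f) from rfl, (h1.mul h2).fderiv]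
      simp
      field_simp
      ring
    · exact ((HasBoundedDerivs.const v.2).mul hQ ((((HasBoundedDerivs.const 1).add hQ hinv).mul hQ
        ((hc.of_succ.mul hQ hun).add hQ hf.of_succ)))).add hQ
        (((hc.2 v).mul hQ hun).add hQ (hf.2 v))

/-- Derivative bounds for a bounded solution of a singularly perturbed nonlinear equation. -/
theorem hasBoundedDerivs_of_nonlinear {S T₀ s₀ c₀ : ℝ} (hT : 1 ≤ T₀) (hs₀ : 0 < s₀) (hc₀ : 0 < c₀)
    {N : (ℝ × ℝ × ℝ) × ℝ → ℝ} (hN : ContDiff ℝ ∞ N) {g : ℝ × ℝ → ℝ}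
    (hg : HasBoundedDerivs (strip S T₀) 0 g)
    (hg0 : ∀ p ∈ strip S T₀, p.1 < s₀ → g p = 0)
    (heq : ∀ p ∈ strip S T₀, fderiv ℝ g p (1, 0) =
      p.2 * Real.exp p.2 * N ((p.1, p.2⁻¹, Real.exp (-p.2)), g p))
    (hneg : ∀ p ∈ strip S T₀,
      fderiv ℝ N ((p.1, p.2⁻¹, Real.exp (-p.2)), g p) (0, 1) ≤ -c₀) (n : ℕ) :
    HasBoundedDerivs (strip S T₀) n g := by
  have hQ := isOpen_strip S T₀
  induction n with
  | zero => exact hg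
  | succ n ih =>
    have hgs := hg.zero_order.1
    set j : ℝ × ℝ → ℝ × ℝ × ℝ := fun p => (p.1, p.2⁻¹, Real.exp (-p.2)) with hj
    have hjn : ∀ n, HasBoundedDerivs (strip S T₀) n j := fun n =>
      (hasBoundedDerivs_fst n S T₀).prodMk hQ
        ((hasBoundedDerivs_inv_snd n S hT).prodMk hQ (hasBoundedDerivs_exp_neg_snd n S hT))
    have hjg := (hjn n).prodMk hQ ih
    have hinv := hasBoundedDerivs_inv_snd n S hT
    have hDN := hjg.comp hQ (hN.fderiv_right (m := ∞) (by simp))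
    refine ⟨hg.zero_order, fun v => ?_⟩
    refine hasBoundedDerivs_of_linear (c := fun p => fderiv ℝ N (j p, g p) (0, 1))
      (f := fun p => v.2 * ((1 + p.2⁻¹) * N (j p, g p)) +
        fderiv ℝ N (j p, g p) (fderiv ℝ j p v, 0)) hT hs₀ hc₀ ?_ ?_ ?_ ?_ hneg ?_
    · exact (hgs.fderiv_of_isOpen hQ (by simp)).clm_apply contDiffOn_const
    · intro p hp hps
      have : g =ᶠ[𝓝 p] fun _ => 0 := by
        filter_upwards [hQ.mem_nhds hp, (isOpen_Iio.preimage continuous_fst).mem_nhds hps]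
          with q hq hq' using hg0 q hq hq'
      rw [this.fderiv_eq]
      simp
    · intro p hp
      have hp2 : T₀ < p.2 := hp.2
      have hp0 : p.2 ≠ 0 := by linarith
      rw [fderiv_fderiv_apply_comm (hgs.contDiffAt (hQ.mem_nhds hp)) v (1, 0)]
      have hev : (fun q => fderiv ℝ g q (1, 0)) =ᶠ[𝓝 p]
          fun q => q.2 * Real.exp q.2 * N (j q, g q) := by
        filter_upwards [hQ.mem_nhds hp] with q hq using heq q hq
      rw [hev.fderiv_eq]
      have h1 := hasFDerivAt_of_snd (f := fun T => T * Real.exp T)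
        ((hasDerivAt_id p.2).mul (Real.hasDerivAt_exp p.2))
      have h2 := (hN.differentiable (by simp) (j p, g p)).hasFDerivAt.comp p
        (((hjn 0).differentiableAt hQ hp).hasFDerivAt.prodMk
        (hg.differentiableAt hQ hp).hasFDerivAt)
      rw [show (fun q : ℝ × ℝ => q.2 * Real.exp q.2 * N (j q, g q)) =
        (fun q : ℝ × ℝ => q.2 * Real.exp q.2) * (N ∘ fun q => (j q, g q)) from rfl,
        (h1.mul h2).fderiv]
      have h3 : fderiv ℝ N (j p, g p) (fderiv ℝ j p v, fderiv ℝ g p v) =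
          fderiv ℝ N (j p, g p) (0, 1) * fderiv ℝ g p v +
          fderiv ℝ N (j p, g p) (fderiv ℝ j p v, 0) := by
        have : ((fderiv ℝ j p v, fderiv ℝ g p v) : (ℝ × ℝ × ℝ) × ℝ) =
            fderiv ℝ g p v • (0, 1) + (fderiv ℝ j p v, 0) := by simp
        rw [this, map_add, map_smul, smul_eq_mul, mul_comm]
      simp [h3]
      field_simp
      ring
    · exact hDN.clm_apply hQ (HasBoundedDerivs.const _)
    · exact ((HasBoundedDerivs.const v.2).mul hQ (((HasBoundedDerivs.const 1).add hQ hinv).mul hQ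
        (hjg.comp hQ hN))).add hQ (hDN.clm_apply hQ (((hjn (n + 1)).2 v).prodMk hQ
          (HasBoundedDerivs.const 0)))

theorem hasBoundedDerivs_sq_mul_exp (n : ℕ) (S : ℝ) {T₀ α : ℝ} (hT : 1 ≤ T₀) (hα : 0 < α) :
    HasBoundedDerivs (strip S T₀) n (fun p : ℝ × ℝ => p.2 ^ 2 * Real.exp (-(α * p.2))) := by
  have hQ := isOpen_strip S T₀
  have h := (((HasBoundedDerivs.const α⁻¹).mul hQ (hasBoundedDerivs_inv_snd n S hT)).comp hQ
    (expNegInvGlue.contDiff_polynomial_eval_inv_mul (n := ⊤) (Polynomial.X ^ 2)))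
  refine ((HasBoundedDerivs.const (α⁻¹ ^ 2)).mul hQ h).congr hQ fun p hp => ?_
  have h2 : T₀ < p.2 := hp.2
  have h3 : 0 < α⁻¹ * p.2⁻¹ := mul_pos (inv_pos.2 hα) (inv_pos.2 (by linarith))
  have h4 : p.2 ≠ 0 := by linarith
  simp [expNegInvGlue, not_le.2 h3]
  field_simp

/-- The extension by zero to `R ≤ 0` of `exp (-α / R) * g (s, 1 / R)`. -/
noncomputable def flatExtension (α : ℝ) (g : ℝ × ℝ → ℝ) (p : ℝ × ℝ) : ℝ :=
  if 0 < p.2 then Real.exp (-(α * p.2⁻¹)) * g (p.1, p.2⁻¹) else 0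

theorem mem_strip_of_inv {S T₀ : ℝ} (hT : 1 ≤ T₀) {p : ℝ × ℝ} (hp : p ∈ Ioo 0 S ×ˢ Iio T₀⁻¹)
    (h0 : 0 < p.2) : (p.1, p.2⁻¹) ∈ strip S T₀ := by
  have h2 : p.2 < T₀⁻¹ := hp.2
  exact ⟨hp.1, by simpa using (lt_inv_comm₀ h0 (by linarith)).1 h2⟩

theorem hasFDerivAt_flatExtension {S T₀ α : ℝ} (hT : 1 ≤ T₀) (hα : 0 < α) {g : ℝ × ℝ → ℝ}
    (hg : HasBoundedDerivs (strip S T₀) 0 g) {p : ℝ × ℝ} (hp : p ∈ Ioo 0 S ×ˢ Iio T₀⁻¹) :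
    HasFDerivAt (flatExtension α g)
      (flatExtension α (fun q => fderiv ℝ g q (1, 0)) p • ContinuousLinearMap.fst ℝ ℝ ℝ +
        flatExtension (α / 2) (fun q => q.2 ^ 2 * Real.exp (-(α / 2 * q.2)) *
          (α * g q + (-1) * fderiv ℝ g q (0, 1))) p • ContinuousLinearMap.snd ℝ ℝ ℝ) p := by
  have hQ := isOpen_strip S T₀
  have hΩ : IsOpen (Ioo 0 S ×ˢ Iio T₀⁻¹ : Set (ℝ × ℝ)) := isOpen_Ioo.prod isOpen_Iio
  by_cases h0 : 0 < p.2
  · have hev : flatExtension α g =ᶠ[𝓝 p]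
        fun q => Real.exp (-(α * q.2⁻¹)) * g (q.1, q.2⁻¹) := by
      filter_upwards [(isOpen_Ioi.preimage continuous_snd).mem_nhds h0] with q hq
      exact if_pos hq
    have h1 := hasFDerivAt_of_snd (p := p) (f := fun R => R⁻¹) (hasDerivAt_inv h0.ne')
    have h2 := hasFDerivAt_of_snd (p := p) (f := fun R => Real.exp (-(α * R⁻¹)))
      (f' := Real.exp (-(α * p.2⁻¹)) * -(α * -(p.2 ^ 2)⁻¹)) ((hasDerivAt_inv h0.ne').const_mul α).neg.exp
    have h3 := (hg.differentiableAt hQ (mem_strip_of_inv hT hp h0)).hasFDerivAt.comp p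
      (hasFDerivAt_fst.prodMk h1)
    refine ((h2.mul h3).congr_of_eventuallyEq hev).congr_fderiv ?_
    have hsplit : ∀ v : ℝ × ℝ, v = v.1 • (1, 0) + v.2 • (0, 1) := fun v => by simp
    have hexp : Real.exp (-(α * p.2⁻¹)) =
        Real.exp (-(α / 2 * p.2⁻¹)) * Real.exp (-(α / 2 * p.2⁻¹)) := by
      rw [← Real.exp_add]
      congr 1
      ring
    refine ContinuousLinearMap.ext fun v => ?_
    simp only [flatExtension, if_pos h0, add_apply, smul_apply, ContinuousLinearMap.comp_apply,
      ContinuousLinearMap.prod_apply, ContinuousLinearMap.coe_fst', ContinuousLinearMap.coe_snd',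
      smul_eq_mul, Function.comp]
    rw [hsplit (v.1, _)]
    simp only [map_add, map_smul, smul_eq_mul, hexp]
    field_simp
    ring
  · have hz : ∀ β f, flatExtension β f p = 0 := fun β f => if_neg h0
    rw [hz, hz, zero_smul, zero_smul, add_zero]
    obtain ⟨-, C, hC⟩ := hg.zero_order
    obtain ⟨-, D, hD⟩ := hasBoundedDerivs_sq_mul_exp 0 S hT hα
    have hbound : ∀ q ∈ Ioo 0 S ×ˢ Iio T₀⁻¹,
        ‖flatExtension α g q‖ ≤ (|D| * |C|) * ‖q - p‖ ^ 2 := by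
      intro q hq
      by_cases hq0 : 0 < q.2
      · have hm := mem_strip_of_inv hT hq hq0
        have h1 := (hD _ hm).trans (le_abs_self D)
        have h2 := (hC _ hm).trans (le_abs_self C)
        have h3 : flatExtension α g q =
            (q.2⁻¹ ^ 2 * Real.exp (-(α * q.2⁻¹))) * g (q.1, q.2⁻¹) * q.2 ^ 2 := by
          rw [flatExtension, if_pos hq0]
          field_simp
        have h4 : q.2 ≤ ‖q - p‖ := by
          have h5 : ‖(q - p).2‖ ≤ ‖q - p‖ := norm_snd_le _
          have h6 : q.2 - p.2 ≤ ‖(q - p).2‖ := le_abs_self _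
          linarith
        rw [h3, norm_mul, norm_mul, Real.norm_of_nonneg (sq_nonneg q.2)]
        gcongr
      · rw [flatExtension, if_neg hq0, norm_zero]
        positivity
    refine HasFDerivAt.of_isLittleO ?_
    rw [hz]
    simp only [sub_zero, zero_apply]
    have hO : (flatExtension α g) =O[𝓝 p] fun q => ‖q - p‖ ^ 2 := by
      refine Asymptotics.IsBigO.of_bound (|D| * |C|) ?_
      filter_upwards [hΩ.mem_nhds hp] with q hq
      simpa using hbound q hq
    have ho : (fun q => ‖q - p‖ ^ 2) =o[𝓝 p] fun q => q - p := by
      have h1 : (fun q : ℝ × ℝ => ‖q - p‖) =o[𝓝 p] fun _ => (1 : ℝ) := by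
        rw [Asymptotics.isLittleO_one_iff]
        have : Continuous fun q : ℝ × ℝ => ‖q - p‖ := by fun_prop
        simpa using this.tendsto p
      have h2 := h1.mul_isBigO (Asymptotics.isBigO_refl (fun q : ℝ × ℝ => ‖q - p‖) (𝓝 p))
      refine (h2.congr (fun q => (sq _).symm) fun q => one_mul _).trans_isBigO ?_
      simpa using (Asymptotics.isBigO_refl (fun q : ℝ × ℝ => q - p) (𝓝 p)).norm_left
    exact hO.trans_isLittleO ho

theorem contDiffOn_flatExtension {S T₀ : ℝ} (hT : 1 ≤ T₀) {n : ℕ} {α : ℝ} (hα : 0 < α)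
    {g : ℝ × ℝ → ℝ} (hg : ∀ m, HasBoundedDerivs (strip S T₀) m g) :
    ContDiffOn ℝ n (flatExtension α g) (Ioo 0 S ×ˢ Iio T₀⁻¹) := by
  have hQ := isOpen_strip S T₀
  have hΩ : IsOpen (Ioo 0 S ×ˢ Iio T₀⁻¹ : Set (ℝ × ℝ)) := isOpen_Ioo.prod isOpen_Iio
  induction n generalizing α g with
  | zero =>
    exact contDiffOn_zero.2 fun p hp =>
      (hasFDerivAt_flatExtension hT hα (hg 0) hp).continuousAt.continuousWithinAt
  | succ n ih =>
    rw [Nat.cast_succ]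
    refine (contDiffOn_succ_iff_fderiv_of_isOpen hΩ).2 ⟨fun p hp =>
      (hasFDerivAt_flatExtension hT hα (hg 0) hp).differentiableAt.differentiableWithinAt,
      fun h => absurd h (by exact_mod_cast WithTop.coe_ne_top), ?_⟩
    have h1 := ih hα (g := fun q => fderiv ℝ g q (1, 0)) fun m => (hg (m + 1)).2 _
    have h2 := ih (half_pos hα) (g := fun q => q.2 ^ 2 * Real.exp (-(α / 2 * q.2)) *
          (α * g q + (-1) * fderiv ℝ g q (0, 1))) fun m =>
      (hasBoundedDerivs_sq_mul_exp m S hT (half_pos hα)).mul hQ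
        (((HasBoundedDerivs.const α).mul hQ (hg m)).add hQ
          ((HasBoundedDerivs.const (-1)).mul hQ ((hg (m + 1)).2 _)))
    exact ((h1.smul contDiffOn_const).add (h2.smul contDiffOn_const)).congr fun p hp =>
      (hasFDerivAt_flatExtension hT hα (hg 0) hp).fderiv

theorem exists_uniform_decay_box {N : (ℝ × ℝ × ℝ) × ℝ → ℝ} (hN : ContDiff ℝ ∞ N) {S c₀ : ℝ}
    (hc₀ : 0 < c₀)
    (hneg : ∀ s ∈ Icc 0 S, ∀ y, fderiv ℝ N ((s, 0, 0), y) (0, 1) ≤ -(2 * c₀)) :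
    ∃ T₀ ≥ (1 : ℝ), ∃ ρ > 0, ∃ M > c₀, ∀ s ∈ Icc 0 S, ∀ T > T₀,
      |N ((s, T⁻¹, Real.exp (-T)), 0)| ≤ c₀ * ρ / 2 ∧ ∀ y ∈ Icc (-ρ) ρ,
        fderiv ℝ N ((s, T⁻¹, Real.exp (-T)), y) (0, 1) ∈ Icc (-M) (-c₀) := by
  have hD : Continuous fun z => fderiv ℝ N z (0, 1) :=
    (hN.continuous_fderiv (by simp)).clm_apply continuous_const
  obtain ⟨C, hC⟩ := ((isCompact_Icc (a := (0 : ℝ)) (b := S)).prod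
    ((isCompact_Icc (a := (0 : ℝ)) (b := 1)).prod
      (isCompact_Icc (a := (0 : ℝ)) (b := 1)))).exists_bound_of_continuousOn
    (f := fun z => N (z, 0)) (by have := hN.continuous; fun_prop)
  set ρ := 2 * (|C| + 1) / c₀ with hρ
  have hρ0 : 0 < ρ := by positivity
  obtain ⟨M, hM⟩ := (((isCompact_Icc (a := (0 : ℝ)) (b := S)).prod
    ((isCompact_Icc (a := (0 : ℝ)) (b := 1)).prod
      (isCompact_Icc (a := (0 : ℝ)) (b := 1)))).prod
      (isCompact_Icc (a := -ρ) (b := ρ))).exists_bound_of_continuousOn hD.continuousOn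
  have hK : IsCompact ((Icc 0 S ×ˢ {((0 : ℝ), (0 : ℝ))}) ×ˢ Icc (-ρ) ρ :
      Set ((ℝ × ℝ × ℝ) × ℝ)) := (isCompact_Icc.prod isCompact_singleton).prod isCompact_Icc
  have hsub : ((Icc 0 S ×ˢ {((0 : ℝ), (0 : ℝ))}) ×ˢ Icc (-ρ) ρ : Set ((ℝ × ℝ × ℝ) × ℝ)) ⊆
      {z | fderiv ℝ N z (0, 1) < -c₀} := by
    rintro ⟨⟨s, R⟩, y⟩ ⟨⟨hs, rfl⟩, -⟩
    have := hneg s hs y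
    exact this.trans_lt (by linarith)
  obtain ⟨η, hη, hsub'⟩ := hK.exists_thickening_subset_open (isOpen_lt hD continuous_const) hsub
  refine ⟨1 + η⁻¹, by simp [hη.le], ρ, hρ0, |M| + c₀ + 1, by linarith [abs_nonneg M], ?_⟩
  intro s hs T hT
  have hη' : 0 < η⁻¹ := inv_pos.2 hη
  have hT0 : 0 < T := by linarith
  have hR : T⁻¹ < η := (inv_lt_comm₀ hT0 hη).2 (by linarith)
  have hR1 : T⁻¹ ≤ 1 := inv_le_one_of_one_le₀ (by linarith)
  have hRpos : 0 < T⁻¹ := inv_pos.2 hT0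
  have hE : Real.exp (-T) ≤ T⁻¹ := by
    rw [Real.exp_neg]
    exact inv_anti₀ hT0 (by linarith [Real.add_one_le_exp T])
  have hEpos := Real.exp_pos (-T)
  have hmem : (s, T⁻¹, Real.exp (-T)) ∈ Icc 0 S ×ˢ Icc (0 : ℝ) 1 ×ˢ Icc (0 : ℝ) 1 :=
    ⟨hs, ⟨hRpos.le, hR1⟩, hEpos.le, hE.trans hR1⟩
  refine ⟨(hC _ hmem).trans ?_, fun y hy => ⟨?_, ?_⟩⟩
  · have : c₀ * ρ / 2 = |C| + 1 := by rw [hρ]; field_simp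
    linarith [le_abs_self C]
  · have := (abs_le.1 (hM _ (mk_mem_prod hmem hy))).1
    linarith [le_abs_self M]
  · refine le_of_lt (hsub' (mem_thickening_iff.2 ⟨((s, 0, 0), y), ⟨⟨hs, rfl⟩, hy⟩, ?_⟩))
    simp [Prod.dist_eq, hη, abs_of_pos hT0, hR, hE.trans_lt hR]

/-- The primitive vanishing at `0`, as an operator on continuous functions on the unit interval. -/
theorem exists_primitiveCLM : ∃ J : C(Icc (0 : ℝ) 1, ℝ) →L[ℝ] C(Icc (0 : ℝ) 1, ℝ),
    ∀ φ θ, J φ θ = ∫ u in (0 : ℝ)..θ, IccExtend zero_le_one φ u := by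
  have hc : ∀ φ : C(Icc (0 : ℝ) 1, ℝ), Continuous (IccExtend zero_le_one φ) := fun φ =>
    φ.continuous.Icc_extend'
  refine ⟨LinearMap.mkContinuous
    { toFun := fun φ => ⟨fun θ => ∫ u in (0 : ℝ)..θ, IccExtend zero_le_one φ u,
        (intervalIntegral.continuous_primitive
          (fun _ _ => (hc φ).intervalIntegrable _ _) 0).comp continuous_subtype_val⟩
      map_add' := fun φ ψ => ?_
      map_smul' := fun a φ => ?_ } 1 fun φ => ?_, fun φ θ => rfl⟩
  · ext θ
    exact intervalIntegral.integral_add ((hc φ).intervalIntegrable _ _)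
      ((hc ψ).intervalIntegrable _ _)
  · ext θ
    exact intervalIntegral.integral_const_mul _ _
  · rw [ContinuousMap.norm_le _ (by positivity)]
    intro θ
    have h := intervalIntegral.norm_integral_le_of_norm_le_const (a := 0) (b := θ) (C := ‖φ‖)
      (f := IccExtend zero_le_one φ) fun u _ => φ.norm_coe_le_norm _
    refine h.trans ?_
    rw [sub_zero, abs_of_nonneg θ.2.1]
    nlinarith [norm_nonneg φ, θ.2.2]

/-- The solution operator `φ ↦ γ` of `γ' = l (φ - γ)`, `γ 0 = 0`, depends smoothly on `l` and is
a contraction for `0 ≤ l`. -/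
theorem exists_relaxation_operator :
    ∃ L : ℝ × C(Icc (0 : ℝ) 1, ℝ) → C(Icc (0 : ℝ) 1, ℝ), ContDiff ℝ ∞ L ∧
      (∀ l φ θ, L (l, φ) θ = l * Real.exp (-(l * θ)) *
        ∫ u in (0 : ℝ)..θ, Real.exp (l * u) * IccExtend zero_le_one φ u) ∧
      (∀ l φ ψ, L (l, φ) - L (l, ψ) = L (l, φ - ψ)) ∧
      ∀ l φ, 0 ≤ l → ‖L (l, φ)‖ ≤ ‖φ‖ := by
  obtain ⟨J, hJ⟩ := exists_primitiveCLM
  let e : C(ℝ, ℝ) := ⟨Real.exp, Real.continuous_exp⟩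
  let ι : C(Icc (0 : ℝ) 1, ℝ) := ⟨Subtype.val, continuous_subtype_val⟩
  have he : ContDiff ℝ ∞ (fun γ : C(Icc (0 : ℝ) 1, ℝ) => e.comp γ) :=
    contDiff_infty.2 fun n => ContinuousMap.contDiff_postcomp n e Real.contDiff_exp
  have hform : ∀ (l : ℝ) (φ : C(Icc (0 : ℝ) 1, ℝ)) (θ : Icc (0 : ℝ) 1), (l • (e.comp (-(l • ι)) * J (e.comp (l • ι) * φ)) : C(Icc (0 : ℝ) 1, ℝ)) θ =
      l * Real.exp (-(l * θ)) *
        ∫ u in (0 : ℝ)..θ, Real.exp (l * u) * IccExtend zero_le_one φ u := by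
    intro l φ θ
    simp only [ContinuousMap.smul_apply, ContinuousMap.mul_apply, hJ, smul_eq_mul, ← mul_assoc]
    congr 1
    refine intervalIntegral.integral_congr fun u hu => ?_
    rw [uIcc_of_le θ.2.1] at hu
    have hu' : u ∈ Icc (0 : ℝ) 1 := ⟨hu.1, hu.2.trans θ.2.2⟩
    simp [IccExtend_of_mem _ _ hu', e, ι]
  refine ⟨fun z => z.1 • (e.comp (-(z.1 • ι)) * J (e.comp (z.1 • ι) * z.2)), ?_, hform, ?_, ?_⟩
  · have h1 : ContDiff ℝ ∞ fun z : ℝ × C(Icc (0 : ℝ) 1, ℝ) => e.comp (z.1 • ι) :=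
      he.comp (contDiff_fst.smul contDiff_const)
    have h2 : ContDiff ℝ ∞ fun z : ℝ × C(Icc (0 : ℝ) 1, ℝ) => e.comp (-(z.1 • ι)) :=
      he.comp (contDiff_fst.smul contDiff_const).neg
    exact contDiff_fst.smul (h2.mul (J.contDiff.comp (h1.mul contDiff_snd)))
  · intro l φ ψ
    simp only [mul_sub, map_sub, smul_sub]
  · intro l φ hl
    rw [ContinuousMap.norm_le _ (norm_nonneg _)]
    intro θ
    rw [hform]
    have hexpint : l * ∫ u in (0 : ℝ)..θ, Real.exp (l * u) = Real.exp (l * θ) - 1 := by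
      have := intervalIntegral.mul_integral_comp_mul_left (f := Real.exp) (a := 0) (b := θ) (c := l)
      rw [this]
      simp
    have h1 : ‖∫ u in (0 : ℝ)..θ, Real.exp (l * u) * IccExtend zero_le_one φ u‖ ≤
        ∫ u in (0 : ℝ)..θ, ‖φ‖ * Real.exp (l * u) := by
      refine intervalIntegral.norm_integral_le_of_norm_le θ.2.1 ?_ ?_
      · refine Eventually.of_forall fun u _ => ?_
        rw [norm_mul, Real.norm_of_nonneg (Real.exp_pos _).le, mul_comm]
        exact mul_le_mul_of_nonneg_right (φ.norm_coe_le_norm _) (Real.exp_pos _).le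
      · exact (by fun_prop : Continuous fun u => ‖φ‖ * Real.exp (l * u)).intervalIntegrable _ _
    rw [intervalIntegral.integral_const_mul] at h1
    rw [norm_mul, norm_mul, Real.norm_of_nonneg hl, Real.norm_of_nonneg (Real.exp_pos _).le]
    have h2 : Real.exp (-(l * θ)) * Real.exp (l * θ) = 1 := by rw [← Real.exp_add]; simp
    calc l * Real.exp (-(l * θ)) * ‖∫ u in (0 : ℝ)..θ, Real.exp (l * u) *
          IccExtend zero_le_one φ u‖
        ≤ l * Real.exp (-(l * θ)) * (‖φ‖ * ∫ u in (0 : ℝ)..θ, Real.exp (l * u)) := by gcongr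
      _ = Real.exp (-(l * θ)) * ‖φ‖ * (l * ∫ u in (0 : ℝ)..θ, Real.exp (l * u)) := by ring
      _ = ‖φ‖ * (1 - Real.exp (-(l * θ))) := by
        rw [hexpint]
        linear_combination ‖φ‖ * h2
      _ ≤ ‖φ‖ := by nlinarith [norm_nonneg φ, Real.exp_pos (-(l * θ))]

/-- Along the interval, `y ↦ y + N y / M` contracts. -/
theorem contraction_of_deriv_bounds {f : ℝ → ℝ} (hf : Differentiable ℝ f) {c₀ M ρ : ℝ}
    (hc₀ : 0 < c₀) (hM : c₀ < M) (hd : ∀ y ∈ Icc (-ρ) ρ, deriv f y ∈ Icc (-M) (-c₀)) :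
    ∀ y ∈ Icc (-ρ) ρ, ∀ z ∈ Icc (-ρ) ρ,
      |(y + M⁻¹ * f y) - (z + M⁻¹ * f z)| ≤ (1 - c₀ / M) * |y - z| := by
  intro y hy z hz
  have hM0 : 0 < M := hc₀.trans hM
  refine Convex.norm_image_sub_le_of_norm_hasDerivWithin_le (f := fun y => y + M⁻¹ * f y)
    (f' := fun y => 1 + M⁻¹ * deriv f y) (s := Icc (-ρ) ρ) (C := 1 - c₀ / M)
    (fun w _ => ((hasDerivAt_id w).add ((hf w).hasDerivAt.const_mul M⁻¹)).hasDerivWithinAt)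
    (fun w hw => ?_) (convex_Icc _ _) hz hy
  obtain ⟨h1, h2⟩ := hd w hw
  have h3 : M⁻¹ * -M ≤ M⁻¹ * deriv f w := mul_le_mul_of_nonneg_left h1 (inv_pos.2 hM0).le
  have h4 : M⁻¹ * deriv f w ≤ M⁻¹ * -c₀ := mul_le_mul_of_nonneg_left h2 (inv_pos.2 hM0).le
  have h5 : M⁻¹ * -M = -1 := by field_simp
  have h6 : M⁻¹ * -c₀ = -(c₀ / M) := by field_simp
  rw [Real.norm_eq_abs, abs_of_nonneg (by linarith)]
  linarith

/-- The bounded solution of the fast-time equation starting at a point where the right-hand side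
is flat, with bounds on all derivatives that are uniform in the singular limit. -/
theorem exists_slow_solution {N : (ℝ × ℝ × ℝ) × ℝ → ℝ} (hN : ContDiff ℝ ∞ N) {S s₀ c₀ : ℝ}
    (hs₀ : 0 < s₀) (hc₀ : 0 < c₀)
    (hneg : ∀ s ∈ Icc 0 S, ∀ y, fderiv ℝ N ((s, 0, 0), y) (0, 1) ≤ -(2 * c₀))
    (h0 : ∀ s ≤ s₀, ∀ R Δ, N ((s, R, Δ), 0) = 0) :
    ∃ T₀ ≥ (1 : ℝ), ∃ g : ℝ × ℝ → ℝ, (∀ n, HasBoundedDerivs (strip S T₀) n g) ∧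
      ∀ p ∈ strip S T₀, HasDerivAt (fun s => g (s, p.2))
        (p.2 * Real.exp p.2 * N ((p.1, p.2⁻¹, Real.exp (-p.2)), g p)) p.1 := by
  obtain ⟨T₀, hT₀, ρ, hρ, M, hM, hbox⟩ := exists_uniform_decay_box hN hc₀ hneg
  obtain ⟨L, hLs, hL, hLsub, hLn⟩ := exists_relaxation_operator
  have hQ := isOpen_strip S T₀
  have hM0 : 0 < M := hc₀.trans hM
  let NN : C((ℝ × ℝ × ℝ) × ℝ, ℝ) := ⟨N, hN.continuous⟩
  let e₁ : C(Icc (0 : ℝ) 1, (ℝ × ℝ × ℝ) × ℝ) := ⟨fun θ => ((θ.1, 0, 0), 0), by fun_prop⟩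
  let e₂ : C(Icc (0 : ℝ) 1, (ℝ × ℝ × ℝ) × ℝ) := ⟨fun θ => ((0, 1, 0), 0), by fun_prop⟩
  let e₃ : C(Icc (0 : ℝ) 1, (ℝ × ℝ × ℝ) × ℝ) := ⟨fun θ => ((0, 0, 1), 0), by fun_prop⟩
  let inc : C(Icc (0 : ℝ) 1, ℝ) →L[ℝ] C(Icc (0 : ℝ) 1, (ℝ × ℝ × ℝ) × ℝ) :=
    (ContinuousLinearMap.inr ℝ (ℝ × ℝ × ℝ) ℝ).compLeftContinuous ℝ (Icc (0 : ℝ) 1)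
  let jj : (ℝ × ℝ) × C(Icc (0 : ℝ) 1, ℝ) → C(Icc (0 : ℝ) 1, (ℝ × ℝ × ℝ) × ℝ) := fun z =>
    z.1.1 • e₁ + z.1.2⁻¹ • e₂ + Real.exp (-z.1.2) • e₃ + inc z.2
  have hjj : ∀ z θ, jj z θ = ((z.1.1 * θ.1, z.1.2⁻¹, Real.exp (-z.1.2)), z.2 θ) := by
    intro z θ
    simp [jj, e₁, e₂, e₃, inc]
  let φ : (ℝ × ℝ) × C(Icc (0 : ℝ) 1, ℝ) → C(Icc (0 : ℝ) 1, ℝ) := fun z =>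
    z.2 + M⁻¹ • NN.comp (jj z)
  have hφ : ∀ z θ, φ z θ = z.2 θ + M⁻¹ *
      N ((z.1.1 * θ.1, z.1.2⁻¹, Real.exp (-z.1.2)), z.2 θ) := by
    intro z θ
    simp only [φ, ContinuousMap.add_apply, ContinuousMap.smul_apply, ContinuousMap.comp_apply, hjj,
      smul_eq_mul]
    rfl
  let F : (ℝ × ℝ) × C(Icc (0 : ℝ) 1, ℝ) → C(Icc (0 : ℝ) 1, ℝ) := fun z =>
    L (M * (z.1.1 * (z.1.2 * Real.exp z.1.2)), φ z)
  have hFs : ContDiffOn ℝ ∞ F (strip S T₀ ×ˢ ball 0 ρ) := by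
    have hNN : ContDiff ℝ ∞ (fun γ : C(Icc (0 : ℝ) 1, (ℝ × ℝ × ℝ) × ℝ) => NN.comp γ) :=
      contDiff_infty.2 fun n => ContinuousMap.contDiff_postcomp n NN hN
    have hinv : ContDiffOn ℝ ∞ (fun z : (ℝ × ℝ) × C(Icc (0 : ℝ) 1, ℝ) => z.1.2⁻¹)
        (strip S T₀ ×ˢ ball 0 ρ) := by
      refine ContDiffOn.inv (by fun_prop) fun z hz => ?_
      have : T₀ < z.1.2 := hz.1.2
      linarith
    have hj : ContDiffOn ℝ ∞ jj (strip S T₀ ×ˢ ball 0 ρ) := by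
      refine ((ContDiffOn.add ?_ ?_).add ?_).add ?_
      · exact (contDiff_fst.fst.smul contDiff_const).contDiffOn
      · exact hinv.smul contDiffOn_const
      · exact (contDiff_fst.snd.neg.exp.smul contDiff_const).contDiffOn
      · exact (inc.contDiff.comp contDiff_snd).contDiffOn
    have hφs : ContDiffOn ℝ ∞ φ (strip S T₀ ×ˢ ball 0 ρ) :=
      contDiffOn_snd.add ((hNN.comp_contDiffOn hj).const_smul M⁻¹)
    exact hLs.comp_contDiffOn (ContDiffOn.prodMk (by fun_prop) hφs)
  have hstrip : ∀ p ∈ strip S T₀, ∀ θ : Icc (0 : ℝ) 1, p.1 * θ.1 ∈ Icc 0 S := fun p hp θ =>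
    ⟨mul_nonneg hp.1.1.le θ.2.1, by nlinarith [hp.1.1, hp.1.2, θ.2.2]⟩
  have hcoord : ∀ γ ∈ closedBall (0 : C(Icc (0 : ℝ) 1, ℝ)) ρ, ∀ θ, γ θ ∈ Icc (-ρ) ρ :=
    fun γ hγ θ => abs_le.1 ((γ.norm_coe_le_norm θ).trans (by simpa using hγ))
  have hcontr : ∀ p ∈ strip S T₀, ∀ θ : Icc (0 : ℝ) 1, ∀ y ∈ Icc (-ρ) ρ, ∀ z ∈ Icc (-ρ) ρ,
      |(y + M⁻¹ * N ((p.1 * θ.1, p.2⁻¹, Real.exp (-p.2)), y)) -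
        (z + M⁻¹ * N ((p.1 * θ.1, p.2⁻¹, Real.exp (-p.2)), z))| ≤ (1 - c₀ / M) * |y - z| := by
    intro p hp θ
    have hder : ∀ y, HasDerivAt (fun y => N ((p.1 * θ.1, p.2⁻¹, Real.exp (-p.2)), y))
        (fderiv ℝ N ((p.1 * θ.1, p.2⁻¹, Real.exp (-p.2)), y) (0, 1)) y := fun y =>
      (hN.differentiable (by simp) _).hasFDerivAt.comp_hasDerivAt y
        ((hasDerivAt_const y _).prodMk (hasDerivAt_id y))
    refine contraction_of_deriv_bounds (fun y => (hder y).differentiableAt) hc₀ hM fun y hy => ?_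
    rw [(hder y).deriv]
    exact (hbox _ (hstrip p hp θ) p.2 hp.2).2 y hy
  have hq0 : 0 ≤ 1 - c₀ / M := by
    rw [sub_nonneg, div_le_one hM0]
    exact hM.le
  have hcM : 0 < c₀ / M := by positivity
  have hl : ∀ p ∈ strip S T₀, 0 ≤ M * (p.1 * (p.2 * Real.exp p.2)) := by
    intro p hp
    have h1 : 0 < p.1 := hp.1.1
    have h2 : T₀ < p.2 := hp.2
    have h3 : 0 < p.2 := by linarith
    positivity
  obtain ⟨γ, hγs, hγ, hγu⟩ := exists_contDiffOn_fixedPoint (x₀ := 0) (ρ := ρ)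
    (ρ' := ρ * (1 - c₀ / M / 2)) (q := 1 - c₀ / M) hQ
    (mul_nonneg hρ.le (by linarith)) (by nlinarith) hq0 (by linarith) hFs
    (by
      intro p hp y hy
      rw [mem_closedBall_zero_iff]
      refine (hLn _ _ (hl p hp)).trans ?_
      rw [ContinuousMap.norm_le _ (mul_nonneg hρ.le (by linarith))]
      intro θ
      rw [hφ, Real.norm_eq_abs]
      have h1 := hcontr p hp θ _ (hcoord y hy θ) 0 ⟨by linarith, hρ.le⟩
      have h2 := (hbox _ (hstrip p hp θ) p.2 hp.2).1
      have h3 : |y θ - 0| ≤ ρ := by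
        rw [sub_zero]
        exact abs_le.2 (hcoord y hy θ)
      have h4 : |M⁻¹ * N ((p.1 * θ.1, p.2⁻¹, Real.exp (-p.2)), 0)| ≤ M⁻¹ * (c₀ * ρ / 2) := by
        rw [abs_mul, abs_of_pos (inv_pos.2 hM0)]
        gcongr
      have h5 := abs_sub_abs_le_abs_sub
        (y θ + M⁻¹ * N ((p.1 * θ.1, p.2⁻¹, Real.exp (-p.2)), y θ))
        (0 + M⁻¹ * N ((p.1 * θ.1, p.2⁻¹, Real.exp (-p.2)), 0))
      rw [zero_add] at h1 h5
      have h6 : M⁻¹ * (c₀ * ρ / 2) = ρ * (c₀ / M / 2) := by field_simp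
      nlinarith [mul_le_mul_of_nonneg_left h3 hq0])
    (by
      intro p hp y hy z hz
      change ‖L _ - L _‖ ≤ _
      rw [hLsub]
      refine (hLn _ _ (hl p hp)).trans ?_
      rw [ContinuousMap.norm_le _ (mul_nonneg hq0 (norm_nonneg _))]
      intro θ
      rw [ContinuousMap.sub_apply, hφ, hφ, Real.norm_eq_abs]
      refine (hcontr p hp θ _ (hcoord y hy θ) _ (hcoord z hz θ)).trans ?_
      exact mul_le_mul_of_nonneg_left ((y - z).norm_coe_le_norm θ) hq0)
  have hγρ : ∀ p ∈ strip S T₀, γ p ∈ closedBall (0 : C(Icc (0 : ℝ) 1, ℝ)) ρ := fun p hp =>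
    closedBall_subset_closedBall (by nlinarith) (hγ p hp).1
  -- rescaling the interval
  have hscale : ∀ p ∈ strip S T₀, ∀ τ : Icc (0 : ℝ) 1, 0 < τ.1 →
      γ (p.1 * τ.1, p.2) 1 = γ p τ := by
    intro p hp τ hτ
    have hp' : (p.1 * τ.1, p.2) ∈ strip S T₀ :=
      ⟨⟨mul_pos hp.1.1 hτ, by nlinarith [hp.1.1, hp.1.2, τ.2.2]⟩, hp.2⟩
    let m : C(Icc (0 : ℝ) 1, Icc (0 : ℝ) 1) :=
      ⟨fun θ => ⟨τ.1 * θ.1, mul_nonneg τ.2.1 θ.2.1, mul_le_one₀ τ.2.2 θ.2.1 θ.2.2⟩, by fun_prop⟩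
    have hmρ : (γ p).comp m ∈ closedBall (0 : C(Icc (0 : ℝ) 1, ℝ)) ρ := by
      rw [mem_closedBall_zero_iff, ContinuousMap.norm_le _ hρ.le]
      intro θ
      exact abs_le.2 (hcoord _ (hγρ p hp) (m θ))
    have hfix : F ((p.1 * τ.1, p.2), (γ p).comp m) = (γ p).comp m := by
      ext θ
      have h1 : (γ p) (m θ) = F (p, γ p) (m θ) := by rw [(hγ p hp).2]
      rw [ContinuousMap.comp_apply, h1]
      simp only [F, hL]
      have h2 := intervalIntegral.mul_integral_comp_mul_left (c := τ.1) (a := 0) (b := θ.1)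
        (f := fun u => Real.exp (M * (p.1 * (p.2 * Real.exp p.2)) * u) *
          IccExtend zero_le_one (φ (p, γ p)) u)
      rw [mul_zero] at h2
      change _ = _ * Real.exp (-(_ * (τ.1 * θ.1))) * ∫ u in (0 : ℝ)..(τ.1 * θ.1), _
      rw [← h2]
      have h3 : ∫ u in (0 : ℝ)..θ, Real.exp (M * (p.1 * τ.1 * (p.2 * Real.exp p.2)) * u) *
            IccExtend zero_le_one (φ ((p.1 * τ.1, p.2), (γ p).comp m)) u =
          ∫ u in (0 : ℝ)..θ, Real.exp (M * (p.1 * (p.2 * Real.exp p.2)) * (τ.1 * u)) *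
            IccExtend zero_le_one (φ (p, γ p)) (τ.1 * u) := by
        refine intervalIntegral.integral_congr fun u hu => ?_
        rw [uIcc_of_le θ.2.1] at hu
        have hu' : u ∈ Icc (0 : ℝ) 1 := ⟨hu.1, hu.2.trans θ.2.2⟩
        have hu'' : τ.1 * u ∈ Icc (0 : ℝ) 1 := (m ⟨u, hu'⟩).2
        simp only [IccExtend_of_mem _ _ hu', IccExtend_of_mem _ _ hu'', hφ]
        have h4 : m ⟨u, hu'⟩ = ⟨τ.1 * u, hu''⟩ := rfl
        rw [ContinuousMap.comp_apply, h4]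
        ring_nf
      rw [h3]
      ring_nf
    have h4 := hγu _ hp' _ hmρ hfix
    rw [← h4, ContinuousMap.comp_apply]
    congr 1
    exact Subtype.ext (mul_one _)
  set g : ℝ × ℝ → ℝ := fun p => γ p 1 with hg
  have hgs : ContDiffOn ℝ ∞ g (strip S T₀) :=
    have hev : IsBoundedLinearMap ℝ fun f : C(Icc (0 : ℝ) 1, ℝ) => f 1 :=
      IsLinearMap.with_bound ⟨fun _ _ => rfl, fun _ _ => rfl⟩ 1 fun f => by
        simpa using f.norm_coe_le_norm 1
    hev.contDiff.comp_contDiffOn hγs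
  have hode : ∀ p ∈ strip S T₀, HasDerivAt (fun s => g (s, p.2))
        (p.2 * Real.exp p.2 * N ((p.1, p.2⁻¹, Real.exp (-p.2)), g p)) p.1 := by
    rintro ⟨s, T⟩ hp
    obtain ⟨s', hs, hs'⟩ := exists_between hp.1.2
    have hs0 : 0 < s := hp.1.1
    have hs0' : 0 < s' := hs0.trans hs
    have hp' : (s', T) ∈ strip S T₀ := ⟨⟨hs0', hs'⟩, hp.2⟩
    set l := M * (s' * (T * Real.exp T)) with hldef
    have hval : ∀ x, ∀ hx : x ∈ Ioo 0 s', g (x, T) = γ (s', T)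
        ⟨x / s', (div_pos hx.1 hs0').le, (div_le_one hs0').2 hx.2.le⟩ := by
      intro x hx
      have := hscale (s', T) hp' ⟨x / s', (div_pos hx.1 hs0').le, (div_le_one hs0').2 hx.2.le⟩
        (div_pos hx.1 hs0')
      rw [← this]
      simp only [hg]
      rw [mul_div_cancel₀ _ hs0'.ne']
    have hcont : Continuous fun u => Real.exp (l * u) *
        IccExtend zero_le_one (φ ((s', T), γ (s', T))) u := by
      have : Continuous (IccExtend zero_le_one (φ ((s', T), γ (s', T)))) :=
        (φ ((s', T), γ (s', T))).continuous.Icc_extend'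
      fun_prop
    have hev : (fun x => g (x, T)) =ᶠ[𝓝 s] fun x => l * Real.exp (-(l * (x / s'))) *
        ∫ u in (0 : ℝ)..(x / s'), Real.exp (l * u) *
          IccExtend zero_le_one (φ ((s', T), γ (s', T))) u := by
      filter_upwards [isOpen_Ioo.mem_nhds (⟨hs0, hs⟩ : s ∈ Ioo 0 s')] with x hx
      rw [hval x hx]
      conv_lhs => rw [← (hγ _ hp').2]
      exact hL _ _ _
    have hdx : HasDerivAt (fun x => x / s') (1 / s') s := (hasDerivAt_id s).div_const s'
    have h1 : HasDerivAt (fun x => l * Real.exp (-(l * (x / s'))))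
        (l * (Real.exp (-(l * (s / s'))) * -(l * (1 / s')))) s :=
      ((hdx.const_mul l).neg.exp).const_mul l
    have h2 := (intervalIntegral.integral_hasDerivAt_right (hcont.intervalIntegrable 0 (s / s'))
      hcont.aestronglyMeasurable.stronglyMeasurableAtFilter hcont.continuousAt).comp s hdx
    have h3 := (h1.mul h2).congr_of_eventuallyEq hev
    refine h3.congr_deriv ?_
    have hθ : s / s' ∈ Icc (0 : ℝ) 1 := ⟨(div_pos hs0 hs0').le, (div_le_one hs0').2 hs.le⟩
    have hgv := hev.self_of_nhds
    simp only at hgv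
    simp only [Function.comp]
    rw [IccExtend_of_mem _ _ hθ, hφ]
    simp only
    rw [← hval s ⟨hs0, hs⟩, mul_div_cancel₀ _ hs0'.ne']
    set I := ∫ u in (0 : ℝ)..(s / s'), Real.exp (l * u) *
          IccExtend zero_le_one (φ ((s', T), γ (s', T))) u
    have hexp : Real.exp (-(l * (s / s'))) * Real.exp (l * (s / s')) = 1 := by
      rw [← Real.exp_add]
      simp
    set E := Real.exp (-(l * (s / s')))
    set E' := Real.exp (l * (s / s'))
    set n := N ((s, T⁻¹, Real.exp (-T)), g (s, T))
    have h5 : l * (1 / s') * M⁻¹ = T * Real.exp T := by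
      rw [hldef]
      field_simp
    linear_combination (l * (1 / s')) * hgv + n * h5 + (l * (1 / s')) * (g (s, T) + M⁻¹ * n) * hexp
  refine ⟨T₀, hT₀, g, hasBoundedDerivs_of_nonlinear hT₀ hs₀ hc₀ hN ⟨hgs, ρ, fun p hp => ?_⟩ ?_ ?_ ?_,
    hode⟩
  · exact abs_le.2 (hcoord _ (hγρ p hp) 1)
  · intro p hp hps
    have : (0 : C(Icc (0 : ℝ) 1, ℝ)) = γ p := by
      refine hγu p hp 0 (mem_closedBall_self hρ.le) ?_
      have h1 : φ (p, 0) = 0 := by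
        ext θ
        rw [hφ]
        simp only [ContinuousMap.zero_apply, zero_add]
        rw [h0 _ (by nlinarith [hp.1.1, θ.2.2]), mul_zero]
      simp only [F]
      rw [h1, ← sub_self (0 : C(Icc (0 : ℝ) 1, ℝ)), ← hLsub, sub_self, sub_self]
    simp only [hg]
    rw [← this]
    rfl
  · intro p hp
    have h1 := ((hgs.contDiffAt (hQ.mem_nhds hp)).differentiableAt (by simp)).hasFDerivAt
    have h2 := HasFDerivAt.comp_hasDerivAt p.1 h1
      ((hasDerivAt_id p.1).prodMk (hasDerivAt_const p.1 p.2))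
    exact h2.unique (hode p hp)
  · intro p hp
    exact ((hbox p.1 ⟨hp.1.1.le, hp.1.2.le⟩ p.2 hp.2).2 _ (hcoord _ (hγρ p hp) 1)).2

/-- A globally smooth function agreeing with the inverse away from zero. -/
theorem exists_contDiff_inv : ∃ ι : ℝ → ℝ, ContDiff ℝ ∞ ι ∧ ∀ w, 1 / 2 ≤ w → ι w = w⁻¹ := by
  refine ⟨fun w => Real.smoothTransition (4 * w - 1) * w⁻¹, ?_, fun w hw => ?_⟩
  · refine contDiff_iff_contDiffAt.2 fun w => ?_
    by_cases hw : w = 0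
    · subst hw
      refine (contDiffAt_const (c := (0 : ℝ))).congr_of_eventuallyEq ?_
      filter_upwards [Iio_mem_nhds (by norm_num : (0 : ℝ) < 1 / 4)] with u hu
      rw [mem_Iio] at hu
      rw [Real.smoothTransition.zero_of_nonpos (by linarith), zero_mul]
    · exact (Real.smoothTransition.contDiff.contDiffAt.comp w
        (by fun_prop : ContDiffAt ℝ ∞ (fun w => 4 * w - 1) w)).mul (contDiffAt_inv ℝ hw)
  · change Real.smoothTransition (4 * w - 1) * w⁻¹ = w⁻¹
    rw [Real.smoothTransition.one_of_one_le (by linarith), one_mul]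

/-- The second order Taylor remainder of the exponential is smooth. -/
theorem exists_contDiff_exp_remainder :
    ∃ ψ : ℝ → ℝ, ContDiff ℝ ∞ ψ ∧ ∀ z, Real.exp z = 1 + z + z ^ 2 * ψ z := by
  set f₁ := dslope Real.exp 0 with hf₁
  set f₂ := dslope f₁ 0 with hf₂
  have hf1 : ∀ z, Real.exp z = 1 + z * f₁ z := fun z => by
    have := sub_smul_dslope Real.exp 0 z
    simp only [sub_zero, smul_eq_mul, Real.exp_zero] at this
    rw [hf₁]
    linarith
  have hf10 : f₁ 0 = 1 := by simp [hf₁, dslope_same]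
  have hf2 : ∀ z, f₁ z = 1 + z * f₂ z := fun z => by
    have := sub_smul_dslope f₁ 0 z
    simp only [sub_zero, smul_eq_mul, hf10] at this
    rw [hf₂]
    linarith
  refine ⟨f₂, contDiff_iff_contDiffAt.2 fun z => ?_, fun z => by rw [hf1, hf2]; ring⟩
  by_cases hz : z = 0
  · subst hz
    obtain ⟨p, hp⟩ := (Real.contDiff_exp (n := ω)).contDiffAt.analyticAt (x := 0)
    exact (hp.has_fpower_series_dslope_fslope.has_fpower_series_dslope_fslope).analyticAt.contDiffAt
  · have : f₂ =ᶠ[𝓝 z] fun z => (Real.exp z - 1 - z) * (z ^ 2)⁻¹ := by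
      filter_upwards [isOpen_ne.mem_nhds hz] with u hu
      rw [hf1, hf2]
      field_simp
      ring
    refine ContDiffAt.congr_of_eventuallyEq ?_ this
    exact ContDiffAt.mul (by fun_prop) (ContDiffAt.inv (by fun_prop) (pow_ne_zero _ hz))

/-- The slow manifold equation in desingularized fast coordinates: `r = 1 / t`, `δ = exp (-t)`,
`y = ε (t + δ H)`. -/
theorem exists_reduced_solution {a b κ S s₀ : ℝ} (ha : 0 < a) (hb : 0 < b) (hκ : 0 < κ)
    (hs₀ : 0 < s₀) {ψ : ℝ → ℝ} (hψ : ContDiff ℝ ∞ ψ) :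
    ∃ T₀ ≥ (1 : ℝ), ∃ g : ℝ × ℝ → ℝ, (∀ n, HasBoundedDerivs (strip S T₀) n g) ∧
      ∃ T₁ ≥ T₀, ∀ s T, 2 * s₀ ≤ s → s < S → T₁ < T →
        ∀ r x δ H X, r = (T - s)⁻¹ → x = -(κ * ((T - s) / T) * Real.exp (-s)) →
          δ = Real.exp (-(T - s)) →
          H = (2 - r * a / (b * x * (1 + r))) / (1 + r) + Real.exp (-T) * g (s, T) →
          X = -x * (1 + r * H * δ) / b →
        0 < a + δ * X ∧ ∃ H', HasDerivAt (fun s =>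
          (2 - (T - s)⁻¹ * a / (b * -(κ * ((T - s) / T) * Real.exp (-s)) * (1 + (T - s)⁻¹))) /
            (1 + (T - s)⁻¹) + Real.exp (-T) * g (s, T)) H' s ∧
          r * δ * H' = r - r * δ * H - b * x * (1 + r) / (a + δ * X) *
            (2 - H * (1 + r) + δ * (2 * r * H - H ^ 2 * ψ (H * δ) -
              r * H ^ 2 * (1 + H * δ * ψ (H * δ)))) := by
  obtain ⟨ι, hι, hι'⟩ := exists_contDiff_inv
  let ξ : ℝ → ℝ := fun s => Real.smoothTransition (s / s₀ - 1)
  have hξ : ContDiff ℝ ∞ ξ := Real.smoothTransition.contDiff.comp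
    (by fun_prop : ContDiff ℝ ∞ fun s : ℝ => s / s₀ - 1)
  let rf : ℝ × ℝ → ℝ := fun p => p.2 * ι (1 - p.1 * p.2)
  have hrf : ContDiff ℝ ∞ rf := by fun_prop
  let af : ℝ × ℝ → ℝ := fun p => κ * (1 - p.1 * p.2) * Real.exp (-p.1)
  have haf : ContDiff ℝ ∞ af := by fun_prop
  let hf : ℝ × ℝ → ℝ := fun p => (2 + rf p * a * ι (1 + rf p) *
    (Real.exp p.1 * ι (1 - p.1 * p.2) / κ) / b) * ι (1 + rf p)
  have hhf : ContDiff ℝ ∞ hf := by fun_prop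
  let dhf : ℝ × ℝ → ℝ := fun p => fderiv ℝ hf p (1, 0)
  have hdhf : ContDiff ℝ ∞ dhf := (hhf.fderiv_right (m := ∞) (by simp)).clm_apply contDiff_const
  let Hf : (ℝ × ℝ × ℝ) × ℝ → ℝ := fun z => hf (z.1.1, z.1.2.1) + z.1.2.2 * z.2
  have hHf : ContDiff ℝ ∞ Hf := by fun_prop
  let δf : (ℝ × ℝ × ℝ) × ℝ → ℝ := fun z => z.1.2.2 * Real.exp z.1.1
  have hδf : ContDiff ℝ ∞ δf := by fun_prop
  let Xf : (ℝ × ℝ × ℝ) × ℝ → ℝ := fun z =>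
    af (z.1.1, z.1.2.1) * (1 + rf (z.1.1, z.1.2.1) * Hf z * δf z) / b
  have hXf : ContDiff ℝ ∞ Xf := by fun_prop
  let Df : (ℝ × ℝ × ℝ) × ℝ → ℝ := fun z => ι (1 + δf z * Xf z / a) / a
  have hDf : ContDiff ℝ ∞ Df := by fun_prop
  let Φ : (ℝ × ℝ × ℝ) × ℝ → ℝ := fun z =>
    -rf (z.1.1, z.1.2.1) * Hf z + b * af (z.1.1, z.1.2.1) * (1 + rf (z.1.1, z.1.2.1)) *
      (Df z * (2 * rf (z.1.1, z.1.2.1) * Hf z - Hf z ^ 2 * ψ (Hf z * δf z) -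
        rf (z.1.1, z.1.2.1) * Hf z ^ 2 * (1 + Hf z * δf z * ψ (Hf z * δf z))) -
      Xf z * Df z / a * (2 - Hf z * (1 + rf (z.1.1, z.1.2.1))))
  have hΦ : ContDiff ℝ ∞ Φ := by fun_prop
  let Bf : ℝ × ℝ → ℝ := fun p => Real.exp (-p.1) * (1 - p.1 * p.2) *
    (b * af p * (1 + rf p) ^ 2 / a)
  have hBf : ContDiff ℝ ∞ Bf := by fun_prop
  let N : (ℝ × ℝ × ℝ) × ℝ → ℝ := fun z => -Bf (z.1.1, z.1.2.1) * z.2 +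
    ξ z.1.1 * ((1 - z.1.1 * z.1.2.1) * Φ z - z.1.2.1 * dhf (z.1.1, z.1.2.1))
  have hN : ContDiff ℝ ∞ N := by fun_prop
  have hξ0 : ∀ s ≤ s₀, ξ s = 0 := fun s hs => Real.smoothTransition.zero_of_nonpos (by
    have := (div_le_one hs₀).2 hs
    linarith)
  have hξ1 : ∀ s, 2 * s₀ ≤ s → ξ s = 1 := fun s hs => Real.smoothTransition.one_of_one_le (by
    have := (le_div_iff₀ hs₀).2 hs
    linarith)
  obtain ⟨T₀, hT₀, g, hg, hode⟩ := exists_slow_solution hN (S := S) (s₀ := s₀)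
    (c₀ := b * κ * Real.exp (-(2 * S)) / (2 * a)) hs₀ (by positivity) (by
      intro s hs y
      have h1 : HasDerivAt (fun y => N ((s, 0, 0), y)) (fderiv ℝ N ((s, 0, 0), y) (0, 1)) y :=
        (hN.differentiable (by simp) _).hasFDerivAt.comp_hasDerivAt y
          ((hasDerivAt_const y _).prodMk (hasDerivAt_id y))
      have h2 : (fun y => N ((s, 0, 0), y)) = fun y => -Bf (s, 0) * y + N ((s, 0, 0), 0) := by
        funext y
        simp [N, Φ, Hf, δf, Xf, Df]
      rw [h2] at h1
      rw [h1.unique (((hasDerivAt_id y).const_mul _).add_const _)]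
      have h3 : Bf (s, 0) = b * κ * Real.exp (-(2 * s)) / a := by
        have : Real.exp (-(2 * s)) = Real.exp (-s) * Real.exp (-s) := by
          rw [← Real.exp_add]
          ring_nf
        rw [this]
        simp [Bf, rf, af]
        ring
      have h4 : Real.exp (-(2 * S)) ≤ Real.exp (-(2 * s)) :=
        Real.exp_le_exp.2 (by linarith [hs.2])
      have h5 : b * κ * Real.exp (-(2 * S)) / a ≤ b * κ * Real.exp (-(2 * s)) / a := by gcongr
      have h6 : 2 * (b * κ * Real.exp (-(2 * S)) / (2 * a)) = b * κ * Real.exp (-(2 * S)) / a := by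
        field_simp
      rw [h3, h6]
      linarith) (by
      intro s hs R Δ
      simp [N, hξ0 s hs])
  refine ⟨T₀, hT₀, g, hg, ?_⟩
  obtain ⟨-, C, hC⟩ := hg 0
  refine ⟨max (max T₀ 2) (max (2 * S) C), (le_max_left _ _).trans (le_max_left _ _), ?_⟩
  intro s T hs hsS hT r x δ H X hr hx hδ hH hX
  have hTT₀ : T₀ < T := ((le_max_left _ _).trans (le_max_left _ _)).trans_lt hT
  have hT2 : 2 < T := ((le_max_right _ _).trans (le_max_left _ _)).trans_lt hT
  have hTS : 2 * S < T := ((le_max_left _ _).trans (le_max_right _ _)).trans_lt hT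
  have hTC : C < T := ((le_max_right _ _).trans (le_max_right _ _)).trans_lt hT
  have hT0 : 0 < T := by linarith
  have hs0 : 0 < s := by linarith
  have hp : (s, T) ∈ strip S T₀ := ⟨⟨hs0, hsS⟩, hTT₀⟩
  have hfrac : ∀ u < S, 1 - u * T⁻¹ = (T - u) / T ∧ 1 / 2 ≤ 1 - u * T⁻¹ ∧ 0 < T - u := by
    intro u hu
    have h1 : 1 - u * T⁻¹ = (T - u) / T := by field_simp
    refine ⟨h1, ?_, by linarith⟩
    rw [h1, le_div_iff₀ hT0]
    linarith
  have hrf' : ∀ u < S, rf (u, T⁻¹) = (T - u)⁻¹ := by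
    intro u hu
    obtain ⟨h1, h2, h3⟩ := hfrac u hu
    simp only [rf]
    rw [hι' _ h2, h1]
    field_simp
  have hhf' : ∀ u < S, hf (u, T⁻¹) =
      (2 - (T - u)⁻¹ * a / (b * -(κ * ((T - u) / T) * Real.exp (-u)) * (1 + (T - u)⁻¹))) /
            (1 + (T - u)⁻¹) := by
    intro u hu
    obtain ⟨h1, h2, h3⟩ := hfrac u hu
    have h4 : 0 < (T - u)⁻¹ := inv_pos.2 h3
    simp only [hf]
    rw [hrf' u hu, hι' _ h2, hι' _ (by linarith), h1, Real.exp_neg]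
    field_simp
    ring
  have ht : 0 < T - s := (hfrac s hsS).2.2
  have hr0 : 0 < r := hr ▸ inv_pos.2 ht
  have hax : af (s, T⁻¹) = -x := by
    simp only [af]
    rw [(hfrac s hsS).1, hx]
    ring
  have hx0 : 0 < -x := by
    rw [hx, neg_neg]
    positivity
  have hrs : rf (s, T⁻¹) = r := by rw [hrf' s hsS, hr]
  set z : (ℝ × ℝ × ℝ) × ℝ := ((s, T⁻¹, Real.exp (-T)), g (s, T)) with hz
  have hHz : Hf z = H := by
    simp only [Hf, hz]
    rw [hhf' s hsS, hH, hr, hx]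
  have hδz : δf z = δ := by
    simp only [δf, hz]
    rw [hδ, ← Real.exp_add]
    ring_nf
  have hXz : Xf z = X := by
    simp only [Xf]
    rw [hHz, hδz]
    simp only [hz]
    rw [hax, hrs, hX]
  have hδ0 : 0 < δ := hδ ▸ Real.exp_pos _
  have hδ1 : δ ≤ 1 := by
    rw [hδ, Real.exp_le_one_iff]
    linarith
  have hX0 : 0 < X := by
    have hr1 : r ≤ 1 := by
      rw [hr]
      exact inv_le_one_of_one_le₀ (by linarith)
    have h1 : |g (s, T)| < Real.exp T :=
      (hC (s, T) hp).trans_lt (hTC.trans (by linarith [Real.add_one_le_exp T]))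
    have h2 : |Real.exp (-T) * g (s, T)| < 1 := by
      rw [abs_mul, abs_of_pos (Real.exp_pos _)]
      calc Real.exp (-T) * |g (s, T)| < Real.exp (-T) * Real.exp T := by gcongr
        _ = 1 := by rw [← Real.exp_add]; simp
    have h3 : 0 < (2 - r * a / (b * x * (1 + r))) / (1 + r) := by
      have : 0 < r * a / (b * -x * (1 + r)) := by positivity
      have h : r * a / (b * x * (1 + r)) = -(r * a / (b * -x * (1 + r))) := by
        rw [mul_neg, neg_mul, div_neg, neg_neg]
      rw [h]
      apply div_pos <;> linarith
    have h4 : -1 < H := by linarith [(abs_lt.1 h2).1]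
    have h5 : r * δ ≤ 1 := mul_le_one₀ hr1 hδ0.le hδ1
    have h6 : 0 < 1 + r * H * δ := by nlinarith [mul_pos hr0 hδ0]
    rw [hX]
    positivity
  have haX : 0 < a + δ * X := by positivity
  have hDz : Df z = (a + δ * X)⁻¹ := by
    have h1 : 0 < δ * X / a := by positivity
    simp only [Df]
    rw [hδz, hXz, hι' _ (by linarith)]
    field_simp
  refine ⟨haX, dhf (s, T⁻¹) + Real.exp (-T) * (T * Real.exp T * N z), ?_, ?_⟩
  · have h1 : HasDerivAt (fun u => hf (u, T⁻¹)) (dhf (s, T⁻¹)) s :=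
      HasFDerivAt.comp_hasDerivAt (f := fun u => (u, T⁻¹)) s
        (hhf.differentiable (by simp) (s, T⁻¹)).hasFDerivAt
        ((hasDerivAt_id s).prodMk (hasDerivAt_const s T⁻¹))
    have h2 := h1.add ((hode (s, T) hp).const_mul (Real.exp (-T)))
    refine h2.congr_of_eventuallyEq ?_
    filter_upwards [isOpen_Iio.mem_nhds hsS] with u hu
    simp only [Pi.add_apply]
    rw [hhf' u hu]
  · have hNz : N z = -(Real.exp (-s) * ((T - s) / T) * (b * -x * (1 + r) ^ 2 / a)) * g (s, T) +
        ((T - s) / T * (-r * H + b * -x * (1 + r) *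
      ((a + δ * X)⁻¹ * (2 * r * H - H ^ 2 * ψ (H * δ) - r * H ^ 2 * (1 + H * δ * ψ (H * δ))) -
      X * (a + δ * X)⁻¹ / a * (2 - H * (1 + r)))) - T⁻¹ * dhf (s, T⁻¹)) := by
      simp only [N, Φ, Bf]
      rw [hHz, hδz, hXz, hDz]
      simp only [hz]
      rw [hax, hrs, hξ1 s hs, (hfrac s hsS).1]
      ring
    have he1 : Real.exp (-T) * Real.exp T = 1 := by rw [← Real.exp_add]; simp
    have he2 : δ * Real.exp (-s) = Real.exp (-T) := by
      rw [hδ, ← Real.exp_add]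
      ring_nf
    have hrt : r * (T - s) = 1 := by rw [hr]; exact inv_mul_cancel₀ ht.ne'
    obtain ⟨D, hD⟩ : ∃ D, D = (a + δ * X)⁻¹ := ⟨_, rfl⟩
    have hD1 : D * (a + δ * X) = 1 := by rw [hD]; exact inv_mul_cancel₀ haX.ne'
    have hDa : 1 / a - δ * X * D / a = D := by
      field_simp
      linear_combination -hD1
    have hlead : b * -x * (1 + r) ^ 2 / a * (H - Real.exp (-T) * g (s, T)) =
        2 * (b * -x) * (1 + r) / a + r := by
      have hr1 : 1 + r ≠ 0 := by positivity
      have hx1 : x ≠ 0 := by linarith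
      rw [hH]
      field_simp
      ring
    have h1 : r * δ * T * N z = -(b * -x * (1 + r) ^ 2 / a) * (Real.exp (-T) * g (s, T)) +
        δ * (-r * H + b * -x * (1 + r) *
      (D * (2 * r * H - H ^ 2 * ψ (H * δ) - r * H ^ 2 * (1 + H * δ * ψ (H * δ))) -
      X * D / a * (2 - H * (1 + r)))) - r * δ * dhf (s, T⁻¹) := by
      rw [hNz, ← hD, ← he2]
      have h2 : r * T * ((T - s) / T) = 1 := by
        rw [← hrt]
        field_simp
      have h3 : T * T⁻¹ = 1 := mul_inv_cancel₀ hT0.ne'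
      generalize (T - s) / T = q at h2 ⊢
      linear_combination (-δ * Real.exp (-s) * (b * -x * (1 + r) ^ 2 / a) * g (s, T) +
        δ * (-r * H + b * -x * (1 + r) *
      (D * (2 * r * H - H ^ 2 * ψ (H * δ) - r * H ^ 2 * (1 + H * δ * ψ (H * δ))) -
      X * D / a * (2 - H * (1 + r))))) * h2 - r * δ * dhf (s, T⁻¹) * h3
    rw [div_eq_mul_inv _ (a + δ * X), ← hD]
    linear_combination h1 + r * δ * T * N z * he1 + hlead +
      b * -x * (1 + r) * (2 - H * (1 + r)) * hDa

theorem abs_log_one_add_sub_le {u v : ℝ} (hu : -(1 / 4) ≤ u) (hv : -(1 / 4) ≤ v) :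
    |Real.log (1 + u) - Real.log (1 + v)| ≤ 4 / 3 * |u - v| := by
  have key : ∀ u v : ℝ, -(1 / 4) ≤ u → -(1 / 4) ≤ v →
      Real.log (1 + u) - Real.log (1 + v) ≤ 4 / 3 * |u - v| := by
    intro u v hu hv
    have hu' : 0 < 1 + u := by linarith
    have hv' : 0 < 1 + v := by linarith
    have h1 := Real.log_le_sub_one_of_pos (div_pos hu' hv')
    rw [Real.log_div hu'.ne' hv'.ne'] at h1
    have h2 : (1 + u) / (1 + v) - 1 ≤ 4 / 3 * |u - v| := by
      rw [div_sub_one hv'.ne', div_le_iff₀ hv']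
      have := abs_nonneg (u - v)
      have := le_abs_self (u - v)
      nlinarith
    linarith
  rw [abs_le]
  have h1 := key u v hu hv
  have h2 := key v u hv hu
  rw [abs_sub_comm v u] at h2
  exact ⟨by linarith, h1⟩

/-- The smooth solution `s` of `s + log (1 + s r) = ℓ`. -/
theorem exists_contDiffOn_shift {Λ : ℝ} (hΛ : 0 < Λ) :
    ∃ β₀ > (0 : ℝ), ∃ σ : ℝ × ℝ → ℝ, ContDiffOn ℝ ∞ σ (Ioo 0 Λ ×ˢ Ioo (-β₀) β₀) ∧
      (∀ p ∈ Ioo 0 Λ ×ˢ Ioo (-β₀) β₀, p.1 / 2 ≤ σ p ∧ σ p < 2 * Λ ∧ 1 / 2 ≤ 1 + σ p * p.2) ∧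
      ∀ p ∈ Ioo 0 Λ ×ˢ Ioo (-β₀) β₀, ∀ s, |s| ≤ 2 * Λ → s + Real.log (1 + s * p.2) = p.1 →
        s = σ p := by
  set β₀ : ℝ := min (1 / 8) (1 / (8 * Λ)) with hβ₀
  have hβ : 0 < β₀ := by positivity
  have hβ1 : β₀ ≤ 1 / 8 := min_le_left _ _
  have hβ2 : Λ * β₀ ≤ 1 / 8 := by
    calc Λ * β₀ ≤ Λ * (1 / (8 * Λ)) := by gcongr; exact min_le_right _ _
      _ = 1 / 8 := by field_simp
  have hsmall : ∀ s r : ℝ, |s| ≤ 2 * Λ → |r| ≤ β₀ → |s * r| ≤ 1 / 4 := by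
    intro s r hs hr
    rw [abs_mul]
    calc |s| * |r| ≤ 2 * Λ * β₀ := by gcongr
      _ ≤ 1 / 4 := by linarith
  have hlip : ∀ s s' r : ℝ, |s| ≤ 2 * Λ → |s'| ≤ 2 * Λ → |r| ≤ β₀ →
      |Real.log (1 + s * r) - Real.log (1 + s' * r)| ≤ 1 / 6 * |s - s'| := by
    intro s s' r hs hs' hr
    have h1 := abs_log_one_add_sub_le (abs_le.1 (hsmall s r hs hr)).1
      (abs_le.1 (hsmall s' r hs' hr)).1
    rw [← sub_mul, abs_mul] at h1
    have := mul_le_mul_of_nonneg_left (hr.trans hβ1) (abs_nonneg (s - s'))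
    linarith
  have hlip0 : ∀ s r : ℝ, |s| ≤ 2 * Λ → |r| ≤ β₀ → |Real.log (1 + s * r)| ≤ 1 / 6 * |s| := by
    intro s r hs hr
    simpa using hlip s 0 r hs (by simpa using hΛ.le) hr
  obtain ⟨σ, hσ, hσ1, hσ2⟩ := exists_contDiffOn_fixedPoint (X := ℝ)
    (U := Ioo (0 : ℝ) Λ ×ˢ Ioo (-β₀) β₀) (isOpen_Ioo.prod isOpen_Ioo)
    (F := fun z : (ℝ × ℝ) × ℝ => z.1.1 - Real.log (1 + z.2 * z.1.2)) (x₀ := 0)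
    (ρ' := 3 / 2 * Λ) (ρ := 2 * Λ) (q := 1 / 2) (by positivity) (by linarith) (by norm_num)
    (by norm_num) (by
      refine ContDiffOn.sub (by fun_prop) (ContDiffOn.log (by fun_prop) ?_)
      rintro z ⟨hz1, hz2⟩
      have h1 : |z.2| ≤ 2 * Λ := by
        simpa using (mem_ball_zero_iff.1 hz2).le
      have := (abs_le.1 (hsmall z.2 z.1.2 h1 (abs_lt.2 hz1.2).le)).1
      linarith) (by
      rintro p hp y hy
      rw [mem_closedBall_zero_iff, Real.norm_eq_abs] at hy ⊢
      have h1 := abs_le.1 (hlip0 y p.2 hy (abs_lt.2 hp.2).le)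
      have h2 := hp.1
      rw [abs_le]
      constructor <;> linarith [h1.1, h1.2, h2.1, h2.2]) (by
      rintro p hp y hy z hz
      rw [mem_closedBall_zero_iff, Real.norm_eq_abs] at hy hz
      have h1 := hlip z y p.2 hz hy (abs_lt.2 hp.2).le
      rw [abs_sub_comm z y] at h1
      have h2 := abs_nonneg (y - z)
      rw [Real.norm_eq_abs, Real.norm_eq_abs, sub_sub_sub_cancel_left]
      linarith)
  refine ⟨β₀, hβ, σ, hσ, fun p hp => ?_, fun p hp s hs h => ?_⟩
  · obtain ⟨h1, h2⟩ := hσ1 p hp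
    rw [mem_closedBall_zero_iff, Real.norm_eq_abs] at h1
    have hr := (abs_lt.2 hp.2).le
    have h3 := (abs_le.1 (hlip0 (σ p) p.2 (by linarith) hr)).2
    have h4 := (abs_le.1 (hsmall (σ p) p.2 (by linarith) hr)).1
    have h5 := hp.1.1
    simp only at h2
    refine ⟨?_, by linarith [le_abs_self (σ p)], by linarith⟩
    rcases abs_cases (σ p) with h6 | h6 <;> linarith [h6.1]
  · refine hσ2 p hp s (by simpa using hs) ?_
    simp only
    linarith

/-- Away from zero a right inverse of `t ↦ t exp t` on the nonnegative reals is differentiable. -/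
theorem hasDerivAt_of_mul_exp_eq {W : ℝ → ℝ}
    (hW : ∀ w : ℝ, 0 ≤ w → 0 ≤ W w ∧ W w * Real.exp (W w) = w) {w : ℝ} (hw : 0 < w) :
    HasDerivAt W (W w / (w * (1 + W w))) w := by
  have hle : ∀ u v, 0 ≤ u → 0 ≤ v → W u - W v ≤ |u - v| := by
    intro u v hu hv
    rcases le_total (W u) (W v) with h | h
    · linarith [abs_nonneg (u - v)]
    · refine le_trans ?_ (le_abs_self _)
      obtain ⟨h1, h2⟩ := hW u hu
      obtain ⟨h3, h4⟩ := hW v hv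
      have h5 := Real.exp_le_exp.2 h
      have h6 := Real.one_le_exp h1
      nlinarith [mul_nonneg (sub_nonneg.2 h) (sub_nonneg.2 h6),
        mul_nonneg h3 (sub_nonneg.2 h5)]
  have hcont : ContinuousAt W w := by
    refine Metric.continuousAt_iff.2 fun e he => ⟨min e w, lt_min he hw, fun {u} hu => ?_⟩
    rw [Real.dist_eq] at hu ⊢
    have h1 := hu.trans_le (min_le_left _ _)
    have h2 := abs_lt.1 (hu.trans_le (min_le_right _ _))
    have h3 := hle u w (by linarith) hw.le
    have h4 := hle w u hw.le (by linarith)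
    rw [abs_sub_comm w u] at h4
    rw [abs_lt]
    constructor <;> linarith
  obtain ⟨h1, h2⟩ := hW w hw.le
  have hpos : 0 < W w := by
    rcases h1.lt_or_eq with h | h
    · exact h
    · rw [← h, zero_mul] at h2
      exact absurd h2 hw.ne
  have hd : HasDerivAt (fun t : ℝ => t * Real.exp t) (w * (1 + W w) / W w) (W w) := by
    have h3 := (hasDerivAt_id (W w)).mul (Real.hasDerivAt_exp (W w))
    refine h3.congr_deriv ?_
    simp only [id]
    field_simp
    linear_combination h2
  have := HasDerivAt.of_local_left_inverse hcont hd (by positivity) (by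
    filter_upwards [isOpen_Ioi.mem_nhds hw] with u hu
    exact (hW u (le_of_lt hu)).2)
  rwa [inv_div] at this

/-- The reduced equation in desingularized coordinates implies the invariance equation. -/
theorem invariance_of_reduced {a b ε t x δ r H H' X : ℝ} {ψ : ℝ → ℝ}
    (hψ : ∀ z, Real.exp z = 1 + z + z ^ 2 * ψ z) (hb : b ≠ 0) (ht : 0 < t) (hx : x < 0)
    (hxt : ε * b * (t * Real.exp t) = -x) (hδ : δ = Real.exp (-t)) (hr : r = t⁻¹)
    (hX : X = -x * (1 + r * H * δ) / b) (haX : a + δ * X ≠ 0)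
    (hH : r * δ * H' = r - r * δ * H - b * x * (1 + r) / (a + δ * X) *
      (2 - H * (1 + r) + δ * (2 * r * H - H ^ 2 * ψ (H * δ) -
        r * H ^ 2 * (1 + H * δ * ψ (H * δ))))) :
    -x + b * (ε * (t + δ * H)) * (2 - Real.exp (t + δ * H)) =
      ε * (t / (x * (1 + t)) * (1 - δ * H - δ * H')) * (ε * (t + δ * H) + a) := by
  have hE : δ * Real.exp t = 1 := by rw [hδ, ← Real.exp_add]; simp
  have hrt : r * t = 1 := by rw [hr]; exact inv_mul_cancel₀ ht.ne'
  have hδx : -x * δ = ε * b * t := by linear_combination -δ * hxt + ε * b * t * hE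
  have hδX : δ * X = ε * (t + δ * H) := by
    rw [hX]
    field_simp
    linear_combination (1 + r * H * δ) * hδx + ε * b * H * δ * hrt
  have hexp : Real.exp (t + δ * H) = Real.exp t * (1 + H * δ + (H * δ) ^ 2 * ψ (H * δ)) := by
    rw [Real.exp_add, mul_comm δ H, hψ (H * δ)]
  generalize ψ (H * δ) = p at *
  generalize Real.exp (t + δ * H) = e at *
  generalize Real.exp t = E at *
  set N := 2 - H * (1 + r) + δ * (2 * r * H - H ^ 2 * p - r * H ^ 2 * (1 + H * δ * p)) with hN
  have hL : -x + b * (ε * (t + δ * H)) * (2 - e) = ε * b * t * N := by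
    rw [hexp, ← hxt, hN]
    linear_combination -(ε * b) * (t * H * (1 + H * δ * p) + H * (1 + H * δ + H ^ 2 * δ ^ 2 * p)) * hE -
      ε * b * (-H + δ * (2 * H - H ^ 2 * (1 + H * δ * p))) * hrt
  rw [hL, add_comm _ a, ← hδX]
  have h1 : r * (1 - δ * H - δ * H') * (a + δ * X) = b * x * (1 + r) * N := by
    have : b * x * (1 + r) / (a + δ * X) * N * (a + δ * X) = b * x * (1 + r) * N := by field_simp
    linear_combination (-(a + δ * X)) * hH + this
  have h2 : (1 - δ * H - δ * H') * (a + δ * X) = b * x * (1 + t) * N := by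
    linear_combination t * h1 + (b * x * N - (1 - δ * H - δ * H') * (a + δ * X)) * hrt
  have hx' : x ≠ 0 := hx.ne
  have ht1 : 1 + t ≠ 0 := by positivity
  have h3 : t / (x * (1 + t)) * (b * x * (1 + t) * N) = b * t * N := by field_simp
  linear_combination -(ε * (t / (x * (1 + t)))) * h2 - ε * h3

theorem lt_of_mul_exp_lt {t u : ℝ} (hu : 0 ≤ u) (h : u * Real.exp u < t * Real.exp t) : u < t := by
  by_contra! htu
  have := Real.exp_le_exp.2 htu
  nlinarith [Real.exp_pos t]

theorem shift_of_mul_exp {e κ x t T : ℝ} (he : 0 < e) (ht : 0 < t) (htT : t < T)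
    (hx : e * (t * Real.exp t) = -x) (hT : e * (T * Real.exp T) = κ) :
    (T - t) + Real.log (1 + (T - t) * t⁻¹) = Real.log (κ / -x) ∧
      x = -(κ * (t / T) * Real.exp (-(T - t))) := by
  have hT0 : 0 < T := ht.trans htT
  have hE : Real.exp (-(T - t)) * Real.exp T = Real.exp t := by
    rw [← Real.exp_add]
    ring_nf
  constructor
  · have h1 : κ / -x = Real.exp (T - t) * (1 + (T - t) * t⁻¹) := by
      rw [← hx, ← hT, Real.exp_sub]
      field_simp
      ring
    have h2 : 0 < 1 + (T - t) * t⁻¹ := by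
      have := mul_pos (sub_pos.2 htT) (inv_pos.2 ht)
      linarith
    rw [h1, Real.log_mul (Real.exp_pos _).ne' h2.ne', Real.log_exp]
  · rw [← neg_eq_iff_eq_neg, ← hx, ← hT, ← hE]
    field_simp

/-- The correction term as a function of `x` and `r = 1 / t`. -/
noncomputable def slowProfile (a b κ : ℝ) (g σ : ℝ × ℝ → ℝ) (x r : ℝ) : ℝ :=
  (2 - r * a / (b * x * (1 + r))) / (1 + r) +
    flatExtension 1 g (σ (Real.log (κ / -x), r), r / (1 + σ (Real.log (κ / -x), r) * r))

theorem contDiffOn_slowProfile {a b κ S T₀ Λ β₀ β₁ : ℝ} {g σ : ℝ × ℝ → ℝ} {J : Set ℝ}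
    (hb : 0 < b) (hκ : 0 < κ) (hT₀ : 1 ≤ T₀) (hg : ∀ n, HasBoundedDerivs (strip S T₀) n g)
    (hσ : ContDiffOn ℝ ∞ σ (Ioo 0 Λ ×ˢ Ioo (-β₀) β₀))
    (hσ' : ∀ p ∈ Ioo 0 Λ ×ˢ Ioo (-β₀) β₀, 0 < σ p ∧ σ p < S ∧ 1 / 2 ≤ 1 + σ p * p.2)
    (hJ : ∀ x ∈ J, x < 0 ∧ Real.log (κ / -x) ∈ Ioo 0 Λ)
    (hβ₀ : β₁ ≤ β₀) (hβT : β₁ ≤ 1 / (2 * T₀)) (hβ₁ : β₁ ≤ 1 / 2) :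
    ContDiffOn ℝ ∞ (fun p : ℝ × ℝ => slowProfile a b κ g σ p.1 p.2) (J ×ˢ Ioo (-β₁) β₁) := by
  have hx : ∀ p ∈ J ×ˢ Ioo (-β₁) β₁, p.1 < 0 := fun p hp => (hJ p.1 hp.1).1
  have hr : ∀ p ∈ J ×ˢ Ioo (-β₁) β₁, 0 < 1 + p.2 := fun p hp => by linarith [hp.2.1]
  have hmem : ∀ p ∈ J ×ˢ Ioo (-β₁) β₁, (Real.log (κ / -p.1), p.2) ∈ Ioo 0 Λ ×ˢ Ioo (-β₀) β₀ :=
    fun p hp => ⟨(hJ p.1 hp.1).2, by linarith [hp.2.1], by linarith [hp.2.2]⟩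
  have hlog : ContDiffOn ℝ ∞ (fun p : ℝ × ℝ => (Real.log (κ / -p.1), p.2))
      (J ×ˢ Ioo (-β₁) β₁) := by
    refine ContDiffOn.prodMk (ContDiffOn.log (ContDiffOn.div (by fun_prop) (by fun_prop) ?_) ?_)
      (by fun_prop)
    · intro p hp
      linarith [hx p hp]
    · intro p hp
      have : 0 < -p.1 := by linarith [hx p hp]
      positivity
  have hσc : ContDiffOn ℝ ∞ (fun p : ℝ × ℝ => σ (Real.log (κ / -p.1), p.2))
      (J ×ˢ Ioo (-β₁) β₁) := hσ.comp hlog hmem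
  refine ContDiffOn.add (ContDiffOn.div (ContDiffOn.sub (by fun_prop)
    (ContDiffOn.div (by fun_prop) (by fun_prop) ?_)) (by fun_prop) ?_) ?_
  · intro p hp
    exact mul_ne_zero (mul_ne_zero hb.ne' (hx p hp).ne) (hr p hp).ne'
  · intro p hp
    exact (hr p hp).ne'
  · have hflat : ContDiffOn ℝ ∞ (flatExtension 1 g) (Ioo 0 S ×ˢ Iio T₀⁻¹) :=
      contDiffOn_infty.2 fun n => contDiffOn_flatExtension hT₀ one_pos hg
    refine hflat.comp (hσc.prodMk (ContDiffOn.div contDiffOn_snd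
      (contDiffOn_const.add (hσc.mul contDiffOn_snd)) ?_)) ?_
    · intro p hp
      have := (hσ' _ (hmem p hp)).2.2
      linarith
    · intro p hp
      obtain ⟨h1, h2, h3⟩ := hσ' _ (hmem p hp)
      simp only at h3
      have hT : 0 < T₀ := by linarith
      refine ⟨⟨h1, h2⟩, ?_⟩
      simp only [mem_Iio]
      rw [div_lt_iff₀ (by linarith)]
      have h4 : p.2 < 1 / 2 * T₀⁻¹ := by
        refine (hp.2.2.trans_le hβT).trans_eq ?_
        field_simp
      have h5 := mul_le_mul_of_nonneg_left h3 (inv_pos.2 hT).le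
      linarith

/-- Existence of an exponentially attracting invariant manifold for the Le Corbeiller system
`ẋ = y + a, ẏ = −x + b·y·(2 − exp(y/ε))`, given as the graph
`y = ε·W(−x/(εb))·(1 − εb·x⁻¹·h(x, W(−x/(εb))⁻¹))` over a compact interval
`I = [c,d] ⊂ (−∞,0)`, where `W` is the principal Lambert-W function on `[0,∞)`. -/
theorem corbeiller_slow_manifold (a b : ℝ) (ha : 0 < a) (hb : b ∈ Set.Ioo (0 : ℝ) 1)
    (c d : ℝ) (hcd : c ≤ d) (hd : d < 0)
    (W : ℝ → ℝ)
    (hW : ∀ w : ℝ, 0 ≤ w → 0 ≤ W w ∧ W w * Real.exp (W w) = w) :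
    ∃ ε₀ > (0 : ℝ), ∃ β > (0 : ℝ), ∃ h : ℝ → ℝ → ℝ,
      ContDiffOn ℝ (⊤ : ℕ∞) (fun p : ℝ × ℝ => h p.1 p.2) (Set.Icc c d ×ˢ Set.Icc 0 β) ∧
      (∀ x ∈ Set.Icc c d, h x 0 = 2) ∧
      ∀ ε ∈ Set.Ioo (0 : ℝ) ε₀,
        (∀ x ∈ Set.Icc c d, (W (-x / (ε * b)))⁻¹ ∈ Set.Icc (0 : ℝ) β) ∧
        (∀ x ∈ Set.Icc c d,
          (fun Y : ℝ → ℝ =>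
            -x + b * Y x * (2 - Real.exp (Y x / ε)) = deriv Y x * (Y x + a))
          (fun x' => ε * W (-x' / (ε * b)) *
            (1 - ε * b * x'⁻¹ * h x' (W (-x' / (ε * b)))⁻¹))) := by
  obtain ⟨hb0, -⟩ := hb
  have hc : c < 0 := hcd.trans_lt hd
  set κ : ℝ := 1 - c with hκ_def
  have hκ : 0 < κ := by linarith
  set J : Set ℝ := Ioo (c - 1 / 2) (d / 2) with hJ_def
  have hIJ : Icc c d ⊆ J := fun x hx => ⟨by linarith [hx.1], by linarith [hx.2]⟩
  set m : ℝ := Real.log (κ / (1 / 2 - c)) with hm_def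
  set Λ : ℝ := Real.log (κ / (-d / 2)) with hΛ_def
  have hm : 0 < m := Real.log_pos (by rw [one_lt_div (by linarith)]; linarith)
  have hJ : ∀ x ∈ J, x < 0 ∧ m < Real.log (κ / -x) ∧ Real.log (κ / -x) < Λ := by
    intro x hx
    have hx0 : x < 0 := by linarith [hx.2]
    refine ⟨hx0, Real.log_lt_log (div_pos hκ (by linarith)) ?_,
      Real.log_lt_log (div_pos hκ (by linarith)) ?_⟩
    · exact div_lt_div_of_pos_left hκ (by linarith) (by linarith [hx.1])
    · exact div_lt_div_of_pos_left hκ (by linarith) (by linarith [hx.2])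
  have hΛ : 0 < Λ := by
    obtain ⟨-, h1, h2⟩ := hJ c (hIJ ⟨le_rfl, hcd⟩)
    linarith
  obtain ⟨ψ, hψ, hψe⟩ := exists_contDiff_exp_remainder
  obtain ⟨T₀, hT₀, g, hg, T₁, hT₁, hred⟩ := exists_reduced_solution (S := 2 * Λ) (s₀ := m / 4)
    ha hb0 hκ (by linarith) hψ
  obtain ⟨β₀, hβ₀, σ, hσ, hσ1, hσ2⟩ := exists_contDiffOn_shift hΛ
  set β₁ : ℝ := min β₀ (min (1 / (2 * T₀)) (1 / 2)) with hβ₁_def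
  have hβ₁ : 0 < β₁ := by positivity
  set β : ℝ := min (β₁ / 2) T₁⁻¹ with hβ_def
  have hT₁0 : 0 < T₁ := by linarith
  have hβ : 0 < β := by positivity
  have hββ : β < β₁ := (min_le_left _ _).trans_lt (by linarith)
  have hβT : T₁ ≤ β⁻¹ := (le_inv_comm₀ hT₁0 hβ).2 (min_le_right _ _)
  refine ⟨(-d / 2) / (b * (β⁻¹ * Real.exp β⁻¹)), div_pos (by linarith) (by positivity), β, hβ,
    slowProfile a b κ g σ, ?_, ?_, ?_⟩
  · refine (contDiffOn_slowProfile hb0 hκ hT₀ hg hσ (fun p hp => ?_)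
      (fun x hx => ⟨(hJ x hx).1, hm.trans (hJ x hx).2.1, (hJ x hx).2.2⟩) (min_le_left _ _)
      ((min_le_right _ _).trans (min_le_left _ _))
      ((min_le_right _ _).trans (min_le_right _ _))).mono (prod_mono hIJ fun r hr => ?_)
    · obtain ⟨h1, h2, h3⟩ := hσ1 p hp
      exact ⟨by linarith [hp.1.1], h2, h3⟩
    · exact ⟨by linarith [hr.1], by linarith [hr.2]⟩
  · intro x hx
    simp [slowProfile, flatExtension]
  rintro ε ⟨hε, hε0⟩
  have hεb : 0 < ε * b := mul_pos hε hb0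
  obtain ⟨T, hT⟩ : ∃ T, T = W (κ / (ε * b)) := ⟨_, rfl⟩
  obtain ⟨hT0, hTe⟩ := hW (κ / (ε * b)) (by positivity)
  rw [← hT] at hT0 hTe
  have hTe' : ε * b * (T * Real.exp T) = κ := by
    rw [hTe]
    field_simp
  obtain ⟨τ, hτ⟩ : ∃ τ : ℝ → ℝ, τ = fun x => W (-x / (ε * b)) := ⟨_, rfl⟩
  have hτe : ∀ x ∈ J, ε * b * (τ x * Real.exp (τ x)) = -x := by
    intro x hx
    simp only [hτ]
    rw [(hW (-x / (ε * b)) (div_nonneg (by linarith [(hJ x hx).1]) hεb.le)).2]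
    field_simp
  have hβτ : ∀ x ∈ J, β⁻¹ < τ x := by
    intro x hx
    refine lt_of_mul_exp_lt (inv_pos.2 hβ).le (lt_of_mul_lt_mul_left ?_ hεb.le)
    rw [hτe x hx]
    rw [lt_div_iff₀ (by positivity)] at hε0
    linarith [hx.2]
  have hτ0 : ∀ x ∈ J, 0 < τ x := fun x hx => (inv_pos.2 hβ).trans (hβτ x hx)
  have hτT : ∀ x ∈ J, τ x < T := by
    intro x hx
    refine lt_of_mul_exp_lt (hτ0 x hx).le (lt_of_mul_lt_mul_left ?_ hεb.le)
    rw [hτe x hx, hTe']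
    linarith [hx.1]
  have hτβ : ∀ x ∈ J, (τ x)⁻¹ < β := fun x hx => inv_lt_of_inv_lt₀ hβ (hβτ x hx)
  have hshift : ∀ x ∈ J, (Real.log (κ / -x), (τ x)⁻¹) ∈ Ioo 0 Λ ×ˢ Ioo (-β₀) β₀ ∧
      T - τ x = σ (Real.log (κ / -x), (τ x)⁻¹) := by
    intro x hx
    obtain ⟨h1, h2, h3⟩ := hJ x hx
    have h4 := inv_pos.2 (hτ0 x hx)
    have h5 : β₁ ≤ β₀ := min_le_left _ _
    have h6 : (Real.log (κ / -x), (τ x)⁻¹) ∈ Ioo 0 Λ ×ˢ Ioo (-β₀) β₀ :=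
      ⟨⟨hm.trans h2, h3⟩, by linarith, by linarith [hτβ x hx]⟩
    refine ⟨h6, ?_⟩
    have h7 := sub_pos.2 (hτT x hx)
    have h8 := (shift_of_mul_exp hεb (hτ0 x hx) (hτT x hx) (hτe x hx) hTe').1
    have h9 : 0 < Real.log (1 + (T - τ x) * (τ x)⁻¹) :=
      Real.log_pos (by linarith [mul_pos h7 h4])
    refine hσ2 _ h6 _ ?_ h8
    rw [abs_of_pos h7]
    linarith
  have hprofile : ∀ x ∈ J, slowProfile a b κ g σ x (τ x)⁻¹ =
      (2 - (τ x)⁻¹ * a / (b * x * (1 + (τ x)⁻¹))) / (1 + (τ x)⁻¹) +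
        Real.exp (-T) * g (T - τ x, T) := by
    intro x hx
    have h1 := hτ0 x hx
    have h2 : (τ x)⁻¹ / (1 + (T - τ x) * (τ x)⁻¹) = T⁻¹ := by
      have h3 : T ≠ 0 := (h1.trans (hτT x hx)).ne'
      have h4 : 1 + (T - τ x) * (τ x)⁻¹ = T / τ x := by
        field_simp
        ring
      rw [h4]
      field_simp
    rw [slowProfile, ← (hshift x hx).2, h2, flatExtension,
      if_pos (inv_pos.2 (h1.trans (hτT x hx)))]
    simp
  refine ⟨fun x hx => ?_, fun x hx => ?_⟩
  · have := hτβ x (hIJ hx)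
    have h0 := inv_pos.2 (hτ0 x (hIJ hx))
    simp only [hτ] at this h0
    exact ⟨h0.le, this.le⟩
  have hxJ := hIJ hx
  have hform : ∀ u ∈ J, ε * W (-u / (ε * b)) *
      (1 - ε * b * u⁻¹ * slowProfile a b κ g σ u (W (-u / (ε * b)))⁻¹) =
      ε * (τ u + Real.exp (-τ u) * slowProfile a b κ g σ u (τ u)⁻¹) := by
    intro u hu
    have h1 : ε * b * τ u * u⁻¹ = -Real.exp (-τ u) := by
      have h2 : u ≠ 0 := (hJ u hu).1.ne
      have h3 : Real.exp (-τ u) * Real.exp (τ u) = 1 := by rw [← Real.exp_add]; simp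
      field_simp
      linear_combination Real.exp (-τ u) * hτe u hu - ε * b * τ u * h3
    rw [show W (-u / (ε * b)) = τ u by rw [hτ]]
    linear_combination -ε * slowProfile a b κ g σ u (τ u)⁻¹ * h1
  obtain ⟨h0x, hmx, hΛx⟩ := hJ x hxJ
  obtain ⟨hmem, hs⟩ := hshift x hxJ
  obtain ⟨hσa, hσb, -⟩ := hσ1 _ hmem
  rw [← hs] at hσa hσb
  have hxs : ∀ u ∈ J, u = -(κ * ((T - (T - τ u)) / T) * Real.exp (-(T - τ u))) := by
    intro u hu
    rw [sub_sub_cancel]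
    exact (shift_of_mul_exp hεb (hτ0 u hu) (hτT u hu) (hτe u hu) hTe').2
  obtain ⟨haX, H', hH', hode⟩ := hred (T - τ x) T (by linarith) hσb
    (hβT.trans_lt ((hβτ x hxJ).trans (hτT x hxJ))) (τ x)⁻¹ x (Real.exp (-τ x))
    (slowProfile a b κ g σ x (τ x)⁻¹) _ (by rw [sub_sub_cancel]) (hxs x hxJ)
    (by rw [sub_sub_cancel]) (hprofile x hxJ) rfl
  have hτ' : HasDerivAt τ (τ x / (x * (1 + τ x))) x := by
    have hw : 0 < -x / (ε * b) := div_pos (by linarith) hεb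
    have h1 := (hasDerivAt_of_mul_exp_eq hW hw).comp x
      ((hasDerivAt_id x).neg.div_const (ε * b))
    rw [hτ]
    refine h1.congr_deriv ?_
    have h2 : 1 + W (-x / (ε * b)) ≠ 0 := by
      have := hτ0 x hxJ
      simp only [hτ] at this
      positivity
    field_simp
  have hY := (hτ'.add ((hτ'.neg.exp).mul (hH'.comp x (hτ'.const_sub T)))).const_mul ε
  have hY' := hY.congr_of_eventuallyEq (f₁ := fun u => ε * W (-u / (ε * b)) *
      (1 - ε * b * u⁻¹ * slowProfile a b κ g σ u (W (-u / (ε * b)))⁻¹)) (by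
    filter_upwards [isOpen_Ioo.mem_nhds hxJ] with u hu
    rw [hform u hu, hprofile u hu]
    simp only [Pi.add_apply, Pi.mul_apply, Function.comp, Pi.neg_apply]
    rw [← hxs u hu, sub_sub_cancel])
  have hinv := invariance_of_reduced (ε := ε) hψe hb0.ne' (hτ0 x hxJ) h0x (hτe x hxJ) rfl rfl rfl
    haX.ne' hode
  beta_reduce
  rw [hY'.deriv, hform x hxJ, mul_div_cancel_left₀ _ hε.ne', hinv]
  congr 1
  simp only [Function.comp, Pi.neg_apply]
  rw [← hxs x hxJ, hprofile x hxJ, sub_sub_cancel]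
  ring
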